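/- Let N₁, N₂ : M_n(ℂ) → M_m(ℂ) be completely positive linear maps that map every nonzero positive semidefinite matrix to a nonzero positive semidefinite matrix (N₁, N₂ ∈ CP⁺). Then lim_{α→1} D_{α,1}(N₁‖N₂) = D^Um(N₁‖N₂) and lim_{α→1} D_{α,α}(N₁‖N₂) = D^Um(N₁‖N₂), where for a divergence D the channel divergence is D(N₁‖N₂) := sup over d ∈ ℕ and density matrices ρ of size dn of D((id_d ⊗ N₁)(ρ) ‖ (id_d ⊗ N₂)(ρ)). More generally, if J ⊆ (0,∞) is an interval containing 1 and z : J∖{1} → (0,∞) satisfies min{α,1} ≤ z(α) for all α ∈ J∖{1}, then lim_{α→1} D_{α,z(α)}(N₁‖N₂) = D^Um(N₁‖N₂). -/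

import Mathlib

open Filter Set Topology
open scoped ComplexOrder

noncomputable section

namespace QRenyi

attribute [local instance] Classical.propDecidable

variable {ι : Type*} [Fintype ι] [DecidableEq ι]

/-- Apply a real function to the eigenvalues of a Hermitian matrix (functional calculus);
junk value `0` for non-Hermitian matrices. -/
noncomputable def hermApply (f : ℝ → ℝ) (A : Matrix ι ι ℂ) : Matrix ι ι ℂ :=
  if hA : A.IsHermitian then hA.cfc f else 0

/-- Real power of a positive semidefinite matrix, taken on its support:
`t ↦ t ^ x` is applied to the nonzero eigenvalues and `0` is mapped to `0`.
In particular `matPow A 0` is the support projection of `A`. -/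
noncomputable def matPow (A : Matrix ι ι ℂ) (x : ℝ) : Matrix ι ι ℂ :=
  hermApply (fun t => if t = 0 then 0 else t ^ x) A

/-- Logarithm of a positive semidefinite matrix taken on its support
(`Real.log 0 = 0` in Mathlib, matching the convention `log̃ 0 = 0`). -/
noncomputable def matLog (A : Matrix ι ι ℂ) : Matrix ι ι ℂ :=
  hermApply Real.log A

/-- `supp ρ ≤ supp σ`, expressed (for PSD matrices) as inclusion of kernels. -/
def suppLE (ρ σ : Matrix ι ι ℂ) : Prop :=
  ∀ v : ι → ℂ, σ.mulVec v = 0 → ρ.mulVec v = 0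

/-- The Loewner (positive semidefinite) order. -/
def loewnerLE (A B : Matrix ι ι ℂ) : Prop := (B - A).PosSemidef

/-- Real part of the trace. -/
noncomputable def reTrace (A : Matrix ι ι ℂ) : ℝ := A.trace.re

/-- The trace quantity `Tr ((σ^{(1-α)/(2z)} ρ^{α/z} σ^{(1-α)/(2z)})^z)` (a real number). -/
noncomputable def Qaz (α z : ℝ) (ρ σ : Matrix ι ι ℂ) : ℝ :=
  reTrace (matPow (matPow σ ((1 - α) / (2 * z)) * matPow ρ (α / z) *
    matPow σ ((1 - α) / (2 * z))) z)

/-- The Rényi `(α,z)`-divergence (for `α ≠ 1`), with values in `EReal = ℝ ∪ {±∞}`.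
It equals `(α-1)⁻¹ (log Q_{α,z}(ρ‖σ) - log Tr ρ)`; it is `+∞` when `α > 1` and
`supp ρ ≰ supp σ`, and also `+∞` when `α < 1` and `Q_{α,z}(ρ‖σ) = 0`
(i.e. `(α-1)⁻¹ log 0 = +∞`). -/
noncomputable def Daz (α z : ℝ) (ρ σ : Matrix ι ι ℂ) : EReal :=
  if (suppLE ρ σ ∨ α < 1) ∧ Qaz α z ρ σ ≠ 0 then
    (((α - 1)⁻¹ * (Real.log (Qaz α z ρ σ) - Real.log (reTrace ρ)) : ℝ) : EReal)
  else ⊤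

/-- The (normalized) Umegaki relative entropy. -/
noncomputable def DUm (ρ σ : Matrix ι ι ℂ) : EReal :=
  if suppLE ρ σ then
    (((reTrace ρ)⁻¹ * reTrace (ρ * (matLog ρ - matLog σ)) : ℝ) : EReal)
  else ⊤

/-- The Rényi `(α,z)`-divergence, with `D_{1,z} := D^Um`. -/
noncomputable def Dfull (α z : ℝ) (ρ σ : Matrix ι ι ℂ) : EReal :=
  if α = 1 then DUm ρ σ else Daz α z ρ σ

/-- The max-relative entropy `D_max(ρ‖σ) = log inf {λ > 0 : ρ ≤ λ σ}`. -/
noncomputable def Dmax (ρ σ : Matrix ι ι ℂ) : EReal :=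
  if ∃ c : ℝ, 0 < c ∧ loewnerLE ρ (c • σ) then
    ((Real.log (sInf {c : ℝ | 0 < c ∧ loewnerLE ρ (c • σ)}) : ℝ) : EReal)
  else ⊤

/-- The classical quantity `Q_α^cl(ρ‖σ) = ∑_x ρ(x)^α σ(x)^{1-α}` (with `0^t = 0` for `t ≠ 0`). -/
noncomputable def Qcl {X : Type*} [Fintype X] (α : ℝ) (ρ σ : X → ℝ) : ℝ :=
  ∑ x, ρ x ^ α * σ x ^ (1 - α)

/-- Absolute continuity `ρ ≪ σ` for functions on a finite set. -/
def acl {X : Type*} (ρ σ : X → ℝ) : Prop := ∀ x, σ x = 0 → ρ x = 0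

/-- The classical Rényi `α`-divergence, with values in `EReal`; for `α = 1` it is the
(normalized) Kullback-Leibler divergence. -/
noncomputable def Dcl {X : Type*} [Fintype X] (α : ℝ) (ρ σ : X → ℝ) : EReal :=
  if α = 1 then
    (if acl ρ σ then
      ((((∑ x, ρ x)⁻¹ * ∑ x, ρ x * (Real.log (ρ x) - Real.log (σ x))) : ℝ) : EReal)
     else ⊤)
  else if (acl ρ σ ∨ α < 1) ∧ Qcl α ρ σ ≠ 0 then
    ((((α - 1)⁻¹ * (Real.log (Qcl α ρ σ) - Real.log (∑ x, ρ x))) : ℝ) : EReal)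
  else ⊤

/-- The measured Rényi `α`-divergence: supremum over all finite-outcome POVMs. -/
noncomputable def Dmeas (α : ℝ) (ρ σ : Matrix ι ι ℂ) : EReal :=
  ⨆ (k : ℕ) (M : Fin k → Matrix ι ι ℂ)
    (_ : (∀ i, (M i).PosSemidef) ∧ ∑ i, M i = 1),
    Dcl α (fun i => reTrace (M i * ρ)) (fun i => reTrace (M i * σ))

/-- A `κ`-function: a continuous nonnegative function on `[0,∞)` with
`limsup_{x→0⁺} f(x) x^{-κ} < ∞`. -/
def IsKappaFunction (κ : ℝ) (f : ℝ → ℝ) : Prop :=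
  ContinuousOn f (Set.Ici 0) ∧ (∀ x ∈ Set.Ici (0 : ℝ), 0 ≤ f x) ∧
    ∃ M : ℝ, ∀ᶠ x in 𝓝[>] (0 : ℝ), f x ≤ M * x ^ κ

/-- A strict `κ`-function: a `κ`-function with `liminf_{x→0⁺} f(x) x^{-κ} > 0`. -/
def IsStrictKappaFunction (κ : ℝ) (f : ℝ → ℝ) : Prop :=
  IsKappaFunction κ f ∧ ∃ c : ℝ, 0 < c ∧ ∀ᶠ x in 𝓝[>] (0 : ℝ), c * x ^ κ ≤ f x

/-- Nonzero PSD matrix predicate. -/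
def PSDne (A : Matrix ι ι ℂ) : Prop := A.PosSemidef ∧ A ≠ 0

/-- The ampliation `id_d ⊗ Φ`, acting blockwise on `d×d` block matrices with `n×n`
blocks: `((id_d ⊗ Φ) X)_{ij} = Φ(X_{ij})`. -/
noncomputable def ampl {n m : ℕ} (d : ℕ)
    (Φ : Matrix (Fin n) (Fin n) ℂ → Matrix (Fin m) (Fin m) ℂ)
    (X : Matrix (Fin d × Fin n) (Fin d × Fin n) ℂ) :
    Matrix (Fin d × Fin m) (Fin d × Fin m) ℂ :=
  Matrix.of fun p q => Φ (Matrix.of fun a b => X (p.1, a) (q.1, b)) p.2 q.2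

/-- Complete positivity of a map on matrices. -/
def IsCP {n m : ℕ} (Φ : Matrix (Fin n) (Fin n) ℂ → Matrix (Fin m) (Fin m) ℂ) : Prop :=
  ∀ (d : ℕ) (X : Matrix (Fin d × Fin n) (Fin d × Fin n) ℂ),
    X.PosSemidef → (ampl d Φ X).PosSemidef

/-- `Φ ∈ CP⁺`: completely positive and mapping nonzero PSD matrices to nonzero PSD
matrices. -/
def IsCPplus {n m : ℕ} (Φ : Matrix (Fin n) (Fin n) ℂ → Matrix (Fin m) (Fin m) ℂ) : Prop :=
  IsCP Φ ∧ ∀ ρ : Matrix (Fin n) (Fin n) ℂ, ρ.PosSemidef → ρ ≠ 0 →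
    (Φ ρ).PosSemidef ∧ Φ ρ ≠ 0

/-- The channel divergence associated to a divergence `D`:
`D(N₁‖N₂) = sup_{d} sup_{ρ density matrix of size dn} D((id_d⊗N₁)ρ ‖ (id_d⊗N₂)ρ)`. -/
noncomputable def chDiv {n m : ℕ}
    (D : ∀ (k : ℕ), Matrix (Fin k × Fin m) (Fin k × Fin m) ℂ →
      Matrix (Fin k × Fin m) (Fin k × Fin m) ℂ → EReal)
    (N₁ N₂ : Matrix (Fin n) (Fin n) ℂ →ₗ[ℂ] Matrix (Fin m) (Fin m) ℂ) : EReal :=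
  ⨆ (d : ℕ) (ρ : Matrix (Fin d × Fin n) (Fin d × Fin n) ℂ)
    (_ : ρ.PosSemidef ∧ ρ.trace = 1),
    D d (ampl d (⇑N₁) ρ) (ampl d (⇑N₂) ρ)

/-- The power `t ^ x` restricted to `t ≠ 0`, with `0` mapped to `0` for every exponent. -/
def suppPow (t x : ℝ) : ℝ := if t = 0 then 0 else t ^ x

lemma suppPow_nonneg {t : ℝ} (ht : 0 ≤ t) (x : ℝ) : 0 ≤ suppPow t x := by
  unfold suppPow; split_ifs
  · exact le_rfl
  · exact Real.rpow_nonneg ht x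

lemma suppPow_mul {t : ℝ} (ht : 0 ≤ t) (x y : ℝ) :
    suppPow t x * suppPow t y = suppPow t (x + y) := by
  unfold suppPow; split_ifs with h
  · simp
  · rw [Real.rpow_add (lt_of_le_of_ne ht (Ne.symm h))]

lemma suppPow_sq {t : ℝ} (ht : 0 ≤ t) (x : ℝ) : suppPow t x ^ 2 = suppPow t (2 * x) := by
  rw [sq, suppPow_mul ht, two_mul]

lemma suppPow_eq_rpow {x : ℝ} (hx : x ≠ 0) (t : ℝ) : suppPow t x = t ^ x := by
  unfold suppPow; split_ifs with h
  · rw [h, Real.zero_rpow hx]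
  · rfl

lemma suppPow_one (t : ℝ) : suppPow t 1 = t := by
  rw [suppPow_eq_rpow one_ne_zero, Real.rpow_one]

lemma suppPow_eq_exp {t : ℝ} (ht : 0 < t) (x : ℝ) :
    suppPow t x = Real.exp (Real.log t * x) := by
  rw [suppPow, if_neg ht.ne', Real.rpow_def_of_pos ht]

/-- Hölder's inequality for doubly substochastic weights. -/
lemma sum_mul_rpow_le {κ : Type*} [Fintype κ] {w : ι → κ → ℝ} (hw : ∀ i k, 0 ≤ w i k)
    (hrow : ∀ i, ∑ k, w i k ≤ 1) (hcol : ∀ k, ∑ i, w i k ≤ 1) {f : ι → ℝ} {g : κ → ℝ}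
    (hf : ∀ i, 0 ≤ f i) (hg : ∀ k, 0 ≤ g k) {θ : ℝ} (h0 : 0 < θ) (h1 : θ < 1) :
    ∑ i, ∑ k, w i k * (f i ^ (1 - θ) * g k ^ θ) ≤ (∑ i, f i) ^ (1 - θ) * (∑ k, g k) ^ θ := by
  have h1' : 0 < 1 - θ := by linarith
  have key := Real.inner_le_Lp_mul_Lq_of_nonneg (s := (Finset.univ : Finset (ι × κ)))
    (f := fun p => (w p.1 p.2 * f p.1) ^ (1 - θ)) (g := fun p => (w p.1 p.2 * g p.2) ^ θ)
    (p := (1 - θ)⁻¹) (q := θ⁻¹)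
    (by
      rw [Real.holderConjugate_iff]
      refine ⟨(one_lt_inv₀ h1').2 (by linarith), by simp⟩)
    (fun p _ => Real.rpow_nonneg (mul_nonneg (hw _ _) (hf _)) _)
    (fun p _ => Real.rpow_nonneg (mul_nonneg (hw _ _) (hg _)) _)
  simp only [Fintype.sum_prod_type, one_div, inv_inv] at key
  have e1 : ∀ i k, ((w i k * f i) ^ (1 - θ)) ^ (1 - θ)⁻¹ = w i k * f i := fun i k =>
    Real.rpow_rpow_inv (mul_nonneg (hw _ _) (hf _)) h1'.ne'
  have e2 : ∀ i k, ((w i k * g k) ^ θ) ^ θ⁻¹ = w i k * g k := fun i k =>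
    Real.rpow_rpow_inv (mul_nonneg (hw _ _) (hg _)) h0.ne'
  have e3 : ∀ i k, (w i k * f i) ^ (1 - θ) * (w i k * g k) ^ θ =
      w i k * (f i ^ (1 - θ) * g k ^ θ) := fun i k => by
    rw [Real.mul_rpow (hw _ _) (hf _), Real.mul_rpow (hw _ _) (hg _)]
    have : w i k ^ (1 - θ) * w i k ^ θ = w i k := by
      rw [← Real.rpow_add' (hw _ _) (by simp)]; simp
    linear_combination (f i ^ (1 - θ) * g k ^ θ) * this
  simp only [e1, e2, e3] at key
  refine key.trans (mul_le_mul ?_ ?_ (Real.rpow_nonneg ?_ _) (Real.rpow_nonneg ?_ _))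
  · refine Real.rpow_le_rpow (Finset.sum_nonneg fun i _ => Finset.sum_nonneg fun k _ =>
      mul_nonneg (hw _ _) (hf _)) (Finset.sum_le_sum fun i _ => ?_) h1'.le
    rw [← Finset.sum_mul]
    exact mul_le_of_le_one_left (hf i) (hrow i)
  · refine Real.rpow_le_rpow (Finset.sum_nonneg fun i _ => Finset.sum_nonneg fun k _ =>
      mul_nonneg (hw _ _) (hg _)) ?_ h0.le
    rw [Finset.sum_comm]
    refine Finset.sum_le_sum fun k _ => ?_
    rw [← Finset.sum_mul]
    exact mul_le_of_le_one_left (hg k) (hcol k)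
  · exact Finset.sum_nonneg fun i _ => Finset.sum_nonneg fun k _ => mul_nonneg (hw _ _) (hg _)
  · exact Finset.sum_nonneg fun i _ => hf i

lemma trace_conjTranspose_mul_self_eq (N : Matrix ι ι ℂ) :
    (N.conjTranspose * N).trace = ((∑ i, ∑ j, ‖N i j‖ ^ 2 : ℝ) : ℂ) := by
  rw [Finset.sum_comm]
  simp [Matrix.trace, Matrix.mul_apply, Complex.conj_mul']

lemma sum_norm_sq_mul_right (N : Matrix ι ι ℂ) {U : Matrix ι ι ℂ}
    (hU : U ∈ Matrix.unitaryGroup ι ℂ) :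
    ∑ i, ∑ j, ‖(N * U) i j‖ ^ 2 = ∑ i, ∑ j, ‖N i j‖ ^ 2 := by
  have h2 := Matrix.mem_unitaryGroup_iff.1 hU
  rw [Matrix.star_eq_conjTranspose] at h2
  apply Complex.ofReal_injective
  rw [← trace_conjTranspose_mul_self_eq, ← trace_conjTranspose_mul_self_eq,
    Matrix.conjTranspose_mul, Matrix.trace_mul_comm]
  calc _ = (N * (U * U.conjTranspose) * N.conjTranspose).trace := by simp only [Matrix.mul_assoc]
    _ = _ := by rw [h2, Matrix.mul_one, Matrix.trace_mul_comm]

lemma sum_norm_sq_mul_left (N : Matrix ι ι ℂ) {U : Matrix ι ι ℂ}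
    (hU : U ∈ Matrix.unitaryGroup ι ℂ) :
    ∑ i, ∑ j, ‖(U * N) i j‖ ^ 2 = ∑ i, ∑ j, ‖N i j‖ ^ 2 := by
  have h2 := Matrix.mem_unitaryGroup_iff'.1 hU
  rw [Matrix.star_eq_conjTranspose] at h2
  apply Complex.ofReal_injective
  rw [← trace_conjTranspose_mul_self_eq, ← trace_conjTranspose_mul_self_eq,
    Matrix.conjTranspose_mul]
  calc _ = (N.conjTranspose * (U.conjTranspose * U) * N).trace := by simp only [Matrix.mul_assoc]
    _ = _ := by rw [h2, Matrix.mul_one]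

lemma unitary_row_sum {U : Matrix ι ι ℂ} (hU : U ∈ Matrix.unitaryGroup ι ℂ) (i : ι) :
    ∑ j, ‖U i j‖ ^ 2 = 1 := by
  have h := congrFun (congrFun (Matrix.mem_unitaryGroup_iff.1 hU) i) i
  rw [Matrix.one_apply_eq, Matrix.mul_apply] at h
  apply Complex.ofReal_injective
  rw [Complex.ofReal_one, ← h]
  simp [Matrix.star_apply, Complex.mul_conj']

lemma unitary_col_sum {U : Matrix ι ι ℂ} (hU : U ∈ Matrix.unitaryGroup ι ℂ) (j : ι) :
    ∑ i, ‖U i j‖ ^ 2 = 1 := by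
  have h := congrFun (congrFun (Matrix.mem_unitaryGroup_iff'.1 hU) j) j
  rw [Matrix.one_apply_eq, Matrix.mul_apply] at h
  apply Complex.ofReal_injective
  rw [Complex.ofReal_one, ← h]
  simp [Matrix.star_apply, Complex.conj_mul']

/-- A unitary matrix acts isometrically on vectors. -/
lemma sum_norm_sq_mulVec {U : Matrix ι ι ℂ} (hU : U ∈ Matrix.unitaryGroup ι ℂ) (v : ι → ℂ) :
    ∑ i, ‖U.mulVec v i‖ ^ 2 = ∑ i, ‖v i‖ ^ 2 := by
  have h2 := Matrix.mem_unitaryGroup_iff'.1 hU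
  rw [Matrix.star_eq_conjTranspose] at h2
  have e : ∀ u : ι → ℂ, ((∑ i, ‖u i‖ ^ 2 : ℝ) : ℂ) = star u ⬝ᵥ u := fun u => by
    simp [dotProduct, Complex.conj_mul']
  apply Complex.ofReal_injective
  rw [e, e, Matrix.star_mulVec, Matrix.dotProduct_mulVec, Matrix.vecMul_vecMul, h2,
    Matrix.vecMul_one]

/-- The complex diagonal matrix with real entries `x`. -/
def realDiag (x : ι → ℝ) : Matrix ι ι ℂ := Matrix.diagonal fun i => (x i : ℂ)

lemma realDiag_mul (x y : ι → ℝ) : realDiag x * realDiag y = realDiag fun i => x i * y i := by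
  simp [realDiag, Matrix.diagonal_mul_diagonal]

lemma sum_norm_sq_diag_mul_diag (x y : ι → ℝ) (C : Matrix ι ι ℂ) :
    ∑ i, ∑ j, ‖(realDiag x * C * realDiag y) i j‖ ^ 2 =
      ∑ i, ∑ j, ‖C i j‖ ^ 2 * (x i ^ 2 * y j ^ 2) := by
  refine Finset.sum_congr rfl fun i _ => Finset.sum_congr rfl fun j _ => ?_
  simp only [realDiag, Matrix.diagonal_mul, Matrix.mul_diagonal, norm_mul, Complex.norm_real,
    Real.norm_eq_abs, mul_pow, sq_abs]
  ring

/-- Hölder-type bound on the power sums of the singular values of a product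
`A ^ (α / 2z) * B ^ c` for `1/2 < z < 1`, in coordinates of the eigenbases. -/
lemma sum_singular_rpow_le_of_lt_one {P C R : Matrix ι ι ℂ} (hP : P ∈ Matrix.unitaryGroup ι ℂ)
    (hR : R ∈ Matrix.unitaryGroup ι ℂ) {a y s : ι → ℝ} (ha : ∀ i, 0 ≤ a i)
    (hs : ∀ i, 0 ≤ s i) {α z : ℝ} (hz : 1 / 2 < z) (hz1 : z < 1)
    (h : P * realDiag (fun i => suppPow (a i) (α / (2 * z))) * C * realDiag y * R =
      realDiag s) :
    ∑ k, s k ^ (2 * z) ≤ (∑ i, a i) ^ (1 - z) *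
      (∑ i, ∑ j, ‖C i j‖ ^ 2 * (suppPow (a i) (1 - (1 - α) / z) * y j ^ 2)) ^ z := by
  have hz0 : 0 < z := by linarith
  set x₁ : ι → ℝ := fun i => suppPow (a i) ((1 - z) / (2 * z)) with hx₁
  set x₂ : ι → ℝ := fun i => suppPow (a i) ((α - 1 + z) / (2 * z)) with hx₂
  set Z := realDiag x₂ * C * realDiag y * R with hZ
  have hx1n : ∀ i, 0 ≤ x₁ i := fun i => suppPow_nonneg (ha i) _
  have hx1sq : ∀ i, x₁ i ^ 2 = a i ^ (1 - (2 * z - 1) / z) := fun i => by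
    rw [hx₁]; dsimp only
    rw [suppPow_sq (ha i), suppPow_eq_rpow]
    · congr 1; field_simp; ring
    · have : 0 < 1 - z := by linarith
      positivity
  have hx2sq : ∀ i, x₂ i ^ 2 = suppPow (a i) (1 - (1 - α) / z) := fun i => by
    rw [hx₂]; dsimp only
    rw [suppPow_sq (ha i)]
    congr 1; field_simp; ring
  have hfac : P * realDiag x₁ * Z = realDiag s := by
    rw [← h, hZ]
    have : realDiag (fun i => suppPow (a i) (α / (2 * z))) = realDiag x₁ * realDiag x₂ := by
      rw [realDiag_mul]; congr 1; ext i
      rw [hx₁, hx₂]; dsimp only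
      rw [suppPow_mul (ha i)]; congr 1; field_simp; ring
    rw [this]; simp only [Matrix.mul_assoc]
  have hfro : ∑ i, ∑ k, ‖Z i k‖ ^ 2 =
      ∑ i, ∑ j, ‖C i j‖ ^ 2 * (suppPow (a i) (1 - (1 - α) / z) * y j ^ 2) := by
    rw [hZ, sum_norm_sq_mul_right _ hR, sum_norm_sq_diag_mul_diag]
    simp only [hx2sq]
  rw [← hfro]
  set F := ∑ i, ∑ k, ‖Z i k‖ ^ 2
  have hF : 0 ≤ F := by positivity
  set S := ∑ k, s k ^ (2 * z) with hS
  set T := ∑ i, a i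
  have hT : 0 ≤ T := Finset.sum_nonneg fun i _ => ha i
  have hSn : 0 ≤ S := Finset.sum_nonneg fun k _ => Real.rpow_nonneg (hs k) _
  rcases hSn.eq_or_lt with hS0 | hSpos
  · rw [← hS0]; positivity
  have hsk : ∀ k, s k ≤ ∑ i, ‖P k i‖ * x₁ i * ‖Z i k‖ := fun k => by
    have e := congrFun (congrFun hfac k) k
    rw [Matrix.mul_apply] at e
    have : s k = ‖realDiag s k k‖ := by
      simp [realDiag, abs_of_nonneg (hs k)]
    rw [this, ← e]
    refine (norm_sum_le _ _).trans (Finset.sum_le_sum fun i _ => ?_)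
    simp [realDiag, Matrix.mul_diagonal, abs_of_nonneg (hx1n i)]
  have hS1 : S ≤ ∑ p : ι × ι, (s p.2 ^ (2 * z - 1) * ‖P p.2 p.1‖ * x₁ p.1) * ‖Z p.1 p.2‖ := by
    rw [Fintype.sum_prod_type, Finset.sum_comm, hS]
    refine Finset.sum_le_sum fun k _ => ?_
    have : s k ^ (2 * z) = s k ^ (2 * z - 1) * s k := by
      rw [← Real.rpow_add_one' (hs k) (by linarith)]; congr 1; ring
    rw [this]
    refine (mul_le_mul_of_nonneg_left (hsk k) (Real.rpow_nonneg (hs k) _)).trans_eq ?_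
    rw [Finset.mul_sum]
    exact Finset.sum_congr rfl fun i _ => by ring
  have hCS := Finset.sum_mul_sq_le_sq_mul_sq (Finset.univ : Finset (ι × ι))
    (fun p => s p.2 ^ (2 * z - 1) * ‖P p.2 p.1‖ * x₁ p.1) (fun p => ‖Z p.1 p.2‖)
  have hfirst : ∑ p : ι × ι, (s p.2 ^ (2 * z - 1) * ‖P p.2 p.1‖ * x₁ p.1) ^ 2 ≤
      T ^ (1 - (2 * z - 1) / z) * S ^ ((2 * z - 1) / z) := by
    rw [Fintype.sum_prod_type]
    have := sum_mul_rpow_le (w := fun i k => ‖P k i‖ ^ 2) (f := a)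
      (g := fun k => s k ^ (2 * z)) (fun _ _ => by positivity)
      (fun i => (unitary_col_sum hP i).le) (fun k => (unitary_row_sum hP k).le) ha
      (fun k => Real.rpow_nonneg (hs k) _) (θ := (2 * z - 1) / z)
      (div_pos (by linarith) hz0) (by rw [div_lt_one hz0]; linarith)
    refine le_trans (le_of_eq ?_) this
    refine Finset.sum_congr rfl fun i _ => Finset.sum_congr rfl fun k _ => ?_
    dsimp only
    rw [mul_pow, mul_pow, hx1sq, ← Real.rpow_mul (hs k), ← Real.rpow_mul_natCast (hs k)]
    have : (2 * z - 1) * ((2 : ℕ) : ℝ) = 2 * z * ((2 * z - 1) / z) := by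
      push_cast; field_simp
    rw [this]; ring
  have hS2 : S ^ 2 ≤ T ^ (1 - (2 * z - 1) / z) * S ^ ((2 * z - 1) / z) * F := by
    refine (pow_le_pow_left₀ hSn hS1 2).trans (hCS.trans ?_)
    rw [Fintype.sum_prod_type (f := fun p : ι × ι => ‖Z p.1 p.2‖ ^ 2)]
    exact mul_le_mul_of_nonneg_right hfirst hF
  have hS3 : S ^ (1 / z) ≤ T ^ (1 - (2 * z - 1) / z) * F := by
    have e : S ^ 2 = S ^ (1 / z) * S ^ ((2 * z - 1) / z) := by
      rw [← Real.rpow_add hSpos, ← Real.rpow_natCast]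
      congr 1; push_cast; field_simp; ring
    rw [e, mul_right_comm] at hS2
    exact le_of_mul_le_mul_right hS2 (Real.rpow_pos_of_pos hSpos _)
  have hS4 := Real.rpow_le_rpow (Real.rpow_nonneg hSn _) hS3 hz0.le
  rw [← Real.rpow_mul hSn, one_div_mul_cancel hz0.ne', Real.rpow_one,
    Real.mul_rpow (Real.rpow_nonneg hT _) hF, ← Real.rpow_mul hT] at hS4
  convert hS4 using 3
  field_simp; ring

/-- Lower bound on the power sums of the singular values of `A ^ e * B ^ c`. -/
lemma le_sum_singular_rpow {P C R : Matrix ι ι ℂ} (hP : P ∈ Matrix.unitaryGroup ι ℂ)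
    (hC : C ∈ Matrix.unitaryGroup ι ℂ)
    (hR : R ∈ Matrix.unitaryGroup ι ℂ) {a x y s : ι → ℝ} (ha : ∀ i, 0 ≤ a i)
    (hs : ∀ i, 0 ≤ s i) {z : ℝ} (hz : 1 / 2 < z)
    (h : P * realDiag x * C * realDiag y * R = realDiag s) :
    ∑ i, ∑ j, ‖C i j‖ ^ 2 * (a i ^ (1 - 1 / (2 * z)) * x i * y j) ≤
      (∑ i, a i) ^ (1 - 1 / (2 * z)) * (∑ k, s k ^ (2 * z)) ^ (1 / (2 * z)) := by
  have hz0 : 0 < z := by linarith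
  have hP1 := Matrix.mem_unitaryGroup_iff'.1 hP
  have hR1 := Matrix.mem_unitaryGroup_iff.1 hR
  set L := star R * star C with hL
  have hLu : L ∈ Matrix.unitaryGroup ι ℂ := mul_mem (Unitary.star_mem hR) (Unitary.star_mem hC)
  have key : realDiag x * C * realDiag y * star C = star P * realDiag s * L := by
    rw [← h, hL]
    calc realDiag x * C * realDiag y * star C
        = (star P * P) * realDiag x * C * realDiag y * (R * star R) * star C := by
          rw [hP1, hR1]; simp
      _ = _ := by simp only [Matrix.mul_assoc]
  have e1 : ∀ i, (realDiag x * C * realDiag y * star C) i i =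
      ((∑ j, ‖C i j‖ ^ 2 * (x i * y j) : ℝ) : ℂ) := fun i => by
    rw [Matrix.mul_apply]
    push_cast
    refine Finset.sum_congr rfl fun j _ => ?_
    rw [← Complex.mul_conj']
    simp only [realDiag, Matrix.diagonal_mul, Matrix.mul_diagonal, Matrix.star_apply,
      RCLike.star_def]
    ring
  have e2 : ∀ i, (∑ j, ‖C i j‖ ^ 2 * (x i * y j)) ≤ ∑ k, ‖P k i‖ * ‖L k i‖ * s k := fun i => by
    refine (Complex.re_le_norm (((∑ j, ‖C i j‖ ^ 2 * (x i * y j) : ℝ) : ℂ))).trans ?_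
    rw [← e1, key, Matrix.mul_apply]
    refine (norm_sum_le _ _).trans (Finset.sum_le_sum fun k _ => ?_)
    simp only [realDiag, Matrix.mul_diagonal, Matrix.star_apply, norm_mul, norm_star,
      Complex.norm_real, Real.norm_eq_abs, abs_of_nonneg (hs k)]
    exact le_of_eq (by ring)
  have hw : ∀ i k, ‖P k i‖ * ‖L k i‖ ≤ (‖P k i‖ ^ 2 + ‖L k i‖ ^ 2) / 2 := fun i k => by
    nlinarith [sq_nonneg (‖P k i‖ - ‖L k i‖)]
  have := sum_mul_rpow_le (w := fun i k => ‖P k i‖ * ‖L k i‖) (f := a)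
      (g := fun k => s k ^ (2 * z)) (fun _ _ => by positivity)
      (fun i => (Finset.sum_le_sum fun k _ => hw i k).trans (by
        rw [← Finset.sum_div, Finset.sum_add_distrib, unitary_col_sum hP, unitary_col_sum hLu]
        norm_num))
      (fun k => (Finset.sum_le_sum fun i _ => hw i k).trans (by
        rw [← Finset.sum_div, Finset.sum_add_distrib, unitary_row_sum hP, unitary_row_sum hLu]
        norm_num)) ha
      (fun k => Real.rpow_nonneg (hs k) _) (θ := 1 / (2 * z))
      (by positivity) (by rw [div_lt_one (by positivity)]; linarith)
  refine le_trans (Finset.sum_le_sum fun i _ => ?_) this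
  have e3 : ∀ k, (s k ^ (2 * z)) ^ (1 / (2 * z)) = s k := fun k => by
    rw [one_div, Real.rpow_rpow_inv (hs k) (by positivity)]
  simp only [e3]
  calc _ = a i ^ (1 - 1 / (2 * z)) * ∑ j, ‖C i j‖ ^ 2 * (x i * y j) := by
        rw [Finset.mul_sum]; exact Finset.sum_congr rfl fun j _ => by ring
    _ ≤ a i ^ (1 - 1 / (2 * z)) * ∑ k, ‖P k i‖ * ‖L k i‖ * s k :=
        mul_le_mul_of_nonneg_left (e2 i) (Real.rpow_nonneg (ha i) _)
    _ = _ := by rw [Finset.mul_sum]; exact Finset.sum_congr rfl fun j _ => by ring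

/-- The entire function `w ↦ t ^ w` for `t ≠ 0`, and `0` for `t = 0`. -/
def suppCpow (t : ℝ) (w : ℂ) : ℂ := if t = 0 then 0 else Complex.exp (Real.log t * w)

lemma norm_suppCpow {t : ℝ} (ht : 0 ≤ t) (w : ℂ) : ‖suppCpow t w‖ = suppPow t w.re := by
  unfold suppCpow suppPow; split_ifs with h
  · simp
  · rw [Complex.norm_exp, Real.rpow_def_of_pos (lt_of_le_of_ne ht (Ne.symm h))]
    simp

lemma suppCpow_ofReal {t : ℝ} (ht : 0 ≤ t) (x : ℝ) : suppCpow t x = (suppPow t x : ℝ) := by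
  unfold suppCpow suppPow; split_ifs with h
  · simp
  · rw [Real.rpow_def_of_pos (lt_of_le_of_ne ht (Ne.symm h))]
    push_cast; rfl

lemma differentiable_suppCpow (t : ℝ) : Differentiable ℂ (suppCpow t) := by
  unfold suppCpow; split_ifs with h
  · exact differentiable_const _
  · fun_prop

lemma continuous_suppPow (t : ℝ) : Continuous (suppPow t) := by
  unfold suppPow; split_ifs with h
  · exact continuous_const
  · exact continuous_const.rpow continuous_id fun _ => Or.inl h

lemma suppPow_zero_le_one (t : ℝ) : suppPow t 0 ≤ 1 := by
  unfold suppPow; split_ifs with h <;> simp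

lemma norm_unitary_mul_diag_le_one {P C R : Matrix ι ι ℂ} (hP : P ∈ Matrix.unitaryGroup ι ℂ)
    (hC : C ∈ Matrix.unitaryGroup ι ℂ) (hR : R ∈ Matrix.unitaryGroup ι ℂ) {d e : ι → ℂ}
    (hd : ∀ i, ‖d i‖ ≤ 1) (he : ∀ i, ‖e i‖ ≤ 1) (k : ι) :
    ‖(P * Matrix.diagonal d * C * Matrix.diagonal e * R) k k‖ ≤ 1 := by
  set v : ι → ℂ := fun j => e j * R j k
  have e1 : (P * Matrix.diagonal d * C * Matrix.diagonal e * R) k k =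
      ∑ i, P k i * d i * C.mulVec v i := by
    rw [Matrix.mul_assoc, Matrix.mul_assoc, Matrix.mul_apply]
    refine Finset.sum_congr rfl fun i _ => ?_
    rw [Matrix.mul_diagonal]
    congr 1
    rw [Matrix.mul_apply]
    simp only [Matrix.mulVec, dotProduct, v, Matrix.diagonal_mul]
  have hv : ∑ i, ‖C.mulVec v i‖ ^ 2 ≤ 1 := by
    rw [sum_norm_sq_mulVec hC, ← unitary_col_sum hR k]
    refine Finset.sum_le_sum fun j _ => ?_
    rw [norm_mul, mul_pow]
    exact mul_le_of_le_one_left (by positivity) (pow_le_one₀ (norm_nonneg _) (he j))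
  rw [e1]
  refine (norm_sum_le _ _).trans ?_
  calc ∑ i, ‖P k i * d i * C.mulVec v i‖
      ≤ ∑ i, (‖P k i‖ ^ 2 + ‖C.mulVec v i‖ ^ 2) / 2 := by
        refine Finset.sum_le_sum fun i _ => ?_
        rw [norm_mul, norm_mul]
        have h1 : ‖P k i‖ * ‖d i‖ ≤ ‖P k i‖ := mul_le_of_le_one_right (norm_nonneg _) (hd i)
        have h2 := mul_le_mul_of_nonneg_right h1 (norm_nonneg (C.mulVec v i))
        nlinarith [sq_nonneg (‖P k i‖ - ‖C.mulVec v i‖)]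
    _ ≤ 1 := by
        rw [← Finset.sum_div, Finset.sum_add_distrib, unitary_row_sum hP]
        linarith

/-- The Lieb–Thirring inequality in coordinates: for `0 < r ≤ 1`, the singular values `s` of
`X ^ r * Y ^ r` satisfy `∑ s ^ (2 / r) ≤ Tr (X ^ 2 * Y ^ 2)`. -/
lemma sum_singular_rpow_le {P C R : Matrix ι ι ℂ} (hP : P ∈ Matrix.unitaryGroup ι ℂ)
    (hC : C ∈ Matrix.unitaryGroup ι ℂ) (hR : R ∈ Matrix.unitaryGroup ι ℂ)
    {x y s : ι → ℝ} (hx : ∀ i, 0 ≤ x i) (hy : ∀ i, 0 ≤ y i)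
    (hs : ∀ i, 0 ≤ s i) {r : ℝ} (hr : 0 < r) (hr1 : r ≤ 1)
    (h : P * realDiag (fun i => suppPow (x i) r) * C * realDiag (fun i => suppPow (y i) r) * R =
      realDiag s) :
    ∑ k, s k ^ (2 / r) ≤ ∑ i, ∑ j, ‖C i j‖ ^ 2 * (x i ^ 2 * y j ^ 2) := by
  set p := 2 / r with hp
  have hp0 : 0 < p := by positivity
  have hp1 : 1 < p := by rw [hp, lt_div_iff₀ hr]; linarith
  have hpr : p * r = 2 := by rw [hp]; field_simp
  set S := ∑ k, s k ^ p with hS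
  have hSn : 0 ≤ S := Finset.sum_nonneg fun k _ => Real.rpow_nonneg (hs k) _
  set G : ℂ → Matrix ι ι ℂ := fun w => P * Matrix.diagonal (fun i => suppCpow (x i) w) * C *
    Matrix.diagonal (fun i => suppCpow (y i) w) * R with hG
  have hGapp : ∀ w k, G w k k = ∑ j, (∑ i, P k i * suppCpow (x i) w * C i j) *
      suppCpow (y j) w * R j k := fun w k => by
    simp only [hG]
    rw [Matrix.mul_apply]
    refine Finset.sum_congr rfl fun j _ => ?_
    rw [Matrix.mul_diagonal, Matrix.mul_apply]
    simp only [Matrix.mul_diagonal]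
  set f : ℂ → ℂ := fun w => ∑ k, suppCpow (s k) (p * (1 - w / 2)) * G w k k with hf
  have hfd : Differentiable ℂ f := by
    rw [hf]
    refine Differentiable.fun_sum fun k _ => ?_
    simp only [hGapp]
    refine Differentiable.mul ((differentiable_suppCpow _).comp (by fun_prop)) ?_
    refine Differentiable.fun_sum fun j _ => ?_
    refine Differentiable.mul (Differentiable.mul ?_ (differentiable_suppCpow _))
      (differentiable_const _)
    refine Differentiable.fun_sum fun i _ => ?_
    exact ((differentiable_const _).mul (differentiable_suppCpow _)).mul (differentiable_const _)
  have hre : ∀ w : ℂ, ((p : ℂ) * (1 - w / 2)).re = p * (1 - w.re / 2) := fun w => by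
    simp [Complex.mul_re]
  set H : ℝ → ℝ := fun t => ∑ k, suppPow (s k) (p * (1 - t / 2)) *
    ∑ j, (∑ i, ‖P k i‖ * suppPow (x i) t * ‖C i j‖) * suppPow (y j) t * ‖R j k‖ with hH
  have hHc : Continuous H := by
    rw [hH]
    refine continuous_finsetSum _ fun k _ => Continuous.mul
      ((continuous_suppPow _).comp (by fun_prop)) ?_
    refine continuous_finsetSum _ fun j _ => Continuous.mul (Continuous.mul ?_
      (continuous_suppPow _)) continuous_const
    exact continuous_finsetSum _ fun i _ =>
      (continuous_const.mul (continuous_suppPow _)).mul continuous_const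
  have hfH : ∀ w, ‖f w‖ ≤ H w.re := fun w => by
    refine (norm_sum_le _ _).trans (Finset.sum_le_sum fun k _ => ?_)
    rw [norm_mul, norm_suppCpow (hs k), hre, hGapp]
    refine mul_le_mul_of_nonneg_left ?_ (suppPow_nonneg (hs k) _)
    refine (norm_sum_le _ _).trans (Finset.sum_le_sum fun j _ => ?_)
    rw [norm_mul, norm_mul, norm_suppCpow (hy j)]
    refine mul_le_mul_of_nonneg_right (mul_le_mul_of_nonneg_right ?_ (suppPow_nonneg (hy j) _))
      (norm_nonneg _)
    refine (norm_sum_le _ _).trans (Finset.sum_le_sum fun i _ => ?_)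
    rw [norm_mul, norm_mul, norm_suppCpow (hx i)]
  have hB : BddAbove ((norm ∘ f) '' Complex.HadamardThreeLines.verticalClosedStrip 0 1) := by
    obtain ⟨K, hK⟩ := (isCompact_Icc (a := (0 : ℝ)) (b := 1)).bddAbove_image hHc.continuousOn
    refine ⟨K, ?_⟩
    rintro _ ⟨w, hw, rfl⟩
    exact (hfH w).trans (hK ⟨w.re, hw, rfl⟩)
  have h0 : ∀ w ∈ Complex.re ⁻¹' {(0 : ℝ)}, ‖f w‖ ≤ S := by
    intro w hw
    have hw' : w.re = 0 := hw
    refine (norm_sum_le _ _).trans (Finset.sum_le_sum fun k _ => ?_)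
    rw [norm_mul, norm_suppCpow (hs k), hre, hw', suppPow_eq_rpow (by simpa using hp0.ne')]
    have : ‖G w k k‖ ≤ 1 := by
      refine norm_unitary_mul_diag_le_one hP hC hR (fun i => ?_) (fun j => ?_) k
      · rw [norm_suppCpow (hx i), hw']; exact suppPow_zero_le_one _
      · rw [norm_suppCpow (hy j), hw']; exact suppPow_zero_le_one _
    simpa using mul_le_mul_of_nonneg_left this (Real.rpow_nonneg (hs k) p)
  set F := ∑ i, ∑ j, ‖C i j‖ ^ 2 * (x i ^ 2 * y j ^ 2) with hF
  have hFn : 0 ≤ F := by positivity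
  have h1 : ∀ w ∈ Complex.re ⁻¹' {(1 : ℝ)}, ‖f w‖ ≤ Real.sqrt (S * F) := by
    intro w hw
    have hw' : w.re = 1 := hw
    have hGF : ∑ k, ‖G w k k‖ ^ 2 ≤ F := by
      have : ∑ i, ∑ j, ‖G w i j‖ ^ 2 = F := by
        simp only [hG]
        rw [sum_norm_sq_mul_right _ hR, Matrix.mul_assoc, Matrix.mul_assoc,
          sum_norm_sq_mul_left _ hP, hF]
        refine Finset.sum_congr rfl fun i _ => Finset.sum_congr rfl fun j _ => ?_
        rw [Matrix.diagonal_mul, Matrix.mul_diagonal, norm_mul, norm_mul, norm_suppCpow (hx i),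
          norm_suppCpow (hy j), hw', suppPow_one, suppPow_one]
        ring
      rw [← this]
      exact Finset.sum_le_sum fun k _ => Finset.single_le_sum (f := fun j => ‖G w k j‖ ^ 2)
        (fun j _ => by positivity) (Finset.mem_univ k)
    refine (norm_sum_le _ _).trans ?_
    apply Real.le_sqrt_of_sq_le
    simp only [norm_mul]
    refine (Finset.sum_mul_sq_le_sq_mul_sq _ _ _).trans ?_
    refine mul_le_mul (le_of_eq ?_) hGF (by positivity) hSn
    refine Finset.sum_congr rfl fun k _ => ?_
    rw [norm_suppCpow (hs k), hre, hw', suppPow_sq (hs k), suppPow_eq_rpow]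
    · congr 1; ring
    · have : 2 * (p * (1 - 1 / 2)) = p := by ring
      rw [this]; exact hp0.ne'
  have hfr : f r = (S : ℝ) := by
    simp only [hf, hS]
    push_cast
    refine Finset.sum_congr rfl fun k _ => ?_
    have e1 : G r k k = (s k : ℂ) := by
      have : G r = realDiag s := by
        rw [← h]
        simp only [hG, realDiag, suppCpow_ofReal (hx _), suppCpow_ofReal (hy _)]
      rw [this]; simp [realDiag]
    have e2 : (p : ℂ) * (1 - r / 2) = ((p - 1 : ℝ) : ℂ) := by
      have : (p : ℂ) * r = 2 := by exact_mod_cast hpr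
      push_cast; linear_combination (-1 / 2) * this
    rw [e1, e2, suppCpow_ofReal (hs k), suppPow_eq_rpow (by linarith : p - 1 ≠ 0),
      ← Complex.ofReal_mul, ← Real.rpow_add_one' (hs k) (by linarith)]
    norm_num
  have key := Complex.HadamardThreeLines.norm_le_interp_of_mem_verticalClosedStrip₀₁' f
    (z := (r : ℂ)) (a := S) (b := Real.sqrt (S * F))
    (by
      show (r : ℂ).re ∈ Set.Icc (0 : ℝ) 1
      simp [hr.le, hr1]) hfd.diffContOnCl hB h0 h1
  rw [hfr, Complex.norm_real, Real.norm_of_nonneg hSn, Complex.ofReal_re] at key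
  rcases hSn.eq_or_lt with hS0 | hSpos
  · rw [← hS0]; exact hFn
  have e3 : Real.sqrt (S * F) ^ r = S ^ (r / 2) * F ^ (r / 2) := by
    rw [Real.sqrt_eq_rpow, ← Real.rpow_mul (mul_nonneg hSn hFn), Real.mul_rpow hSn hFn]
    congr 2 <;> ring
  have e4 : S = S ^ (1 - r) * S ^ (r / 2) * S ^ (r / 2) := by
    rw [← Real.rpow_add hSpos, ← Real.rpow_add hSpos]
    ring_nf; simp
  rw [e3, ← mul_assoc] at key
  nth_rewrite 1 [e4] at key
  have h5 : S ^ (r / 2) ≤ F ^ (r / 2) := le_of_mul_le_mul_left key (by positivity)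
  exact (Real.rpow_le_rpow_iff hSn hFn (by positivity)).1 h5

/-- A unitary diagonalization of a positive semidefinite matrix which is compatible with
the functional calculus. -/
structure SpectralData (A : Matrix ι ι ℂ) where
  /-- The diagonalizing unitary. -/
  U : Matrix ι ι ℂ
  /-- The eigenvalues. -/
  eig : ι → ℝ
  mem_unitary : U ∈ Matrix.unitaryGroup ι ℂ
  eig_nonneg : ∀ i, 0 ≤ eig i
  hermApply_eq : ∀ f : ℝ → ℝ, hermApply f A = U * realDiag (fun i => f (eig i)) * star U
  eq : A = U * realDiag eig * star U

lemma exists_spectralData {A : Matrix ι ι ℂ} (hA : A.PosSemidef) : Nonempty (SpectralData A) := by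
  refine ⟨⟨(hA.1.eigenvectorUnitary : Matrix ι ι ℂ), hA.1.eigenvalues,
    hA.1.eigenvectorUnitary.2, hA.eigenvalues_nonneg, fun f => ?_, ?_⟩⟩
  · rw [hermApply, dif_pos hA.1, Matrix.IsHermitian.cfc, Unitary.conjStarAlgAut_apply]
    rfl
  · conv_lhs => rw [hA.1.spectral_theorem, Unitary.conjStarAlgAut_apply]
    rfl

lemma SpectralData.matPow_eq {A : Matrix ι ι ℂ} (D : SpectralData A) (x : ℝ) :
    matPow A x = D.U * realDiag (fun i => suppPow (D.eig i) x) * star D.U :=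
  D.hermApply_eq _

lemma reTrace_conj_realDiag {U : Matrix ι ι ℂ} (hU : U ∈ Matrix.unitaryGroup ι ℂ) (x : ι → ℝ) :
    reTrace (U * realDiag x * star U) = ∑ i, x i := by
  rw [reTrace, Matrix.trace_mul_comm, ← Matrix.mul_assoc, Matrix.mem_unitaryGroup_iff'.1 hU,
    Matrix.one_mul, realDiag, Matrix.trace_diagonal]
  simp

lemma SpectralData.reTrace_eq {A : Matrix ι ι ℂ} (D : SpectralData A) :
    reTrace A = ∑ i, D.eig i := by
  conv_lhs => rw [D.eq]
  exact reTrace_conj_realDiag D.mem_unitary _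

lemma star_realDiag (x : ι → ℝ) : star (realDiag x) = realDiag x := by
  rw [Matrix.star_eq_conjTranspose, realDiag, Matrix.diagonal_conjTranspose]
  congr 1; ext i; simp

/-- A matrix with orthogonal columns is a unitary times a nonnegative diagonal matrix. -/
lemma exists_unitary_mul_realDiag {N : Matrix ι ι ℂ} {μ : ι → ℝ} (hμ : ∀ i, 0 ≤ μ i)
    (h : star N * N = realDiag μ) :
    ∃ U ∈ Matrix.unitaryGroup ι ℂ, N = U * realDiag fun i => Real.sqrt (μ i) := by
  have hent : ∀ k l, ∑ i, star (N i k) * N i l = if k = l then (μ k : ℂ) else 0 := fun k l => by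
    have := congrFun (congrFun h k) l
    rw [Matrix.mul_apply] at this
    simpa [realDiag, Matrix.diagonal_apply, Matrix.star_apply] using this
  set v : ι → EuclideanSpace ℂ ι := fun k => WithLp.toLp 2 fun i => N i k / (Real.sqrt (μ k) : ℂ)
    with hv
  have hinner : ∀ k l, inner ℂ (v k) (v l) =
      (∑ i, star (N i k) * N i l) / ((Real.sqrt (μ k) : ℂ) * (Real.sqrt (μ l) : ℂ)) :=
    fun k l => by
    rw [PiLp.inner_apply, Finset.sum_div]
    refine Finset.sum_congr rfl fun i _ => ?_
    simp [hv, div_eq_mul_inv]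
    ring
  have hon : Orthonormal ℂ (({k | μ k ≠ 0} : Set ι).domRestrict v) := by
    rw [orthonormal_iff_ite]
    rintro ⟨k, hk⟩ ⟨l, hl⟩
    rw [Set.domRestrict_apply, Set.domRestrict_apply, hinner, hent]
    by_cases hkl : k = l
    · subst hkl
      have : (μ k : ℂ) ≠ 0 := by exact_mod_cast hk
      rw [if_pos rfl, if_pos rfl, ← Complex.ofReal_mul, Real.mul_self_sqrt (hμ k), div_self this]
    · rw [if_neg hkl, if_neg (by simpa using hkl), zero_div]
  obtain ⟨b, hb⟩ := hon.exists_orthonormalBasis_extension_of_card_eq (by simp)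
  refine ⟨Matrix.of fun i k => b k i, ?_, ?_⟩
  · rw [Matrix.mem_unitaryGroup_iff']
    ext k l
    have := orthonormal_iff_ite.1 b.orthonormal k l
    rw [PiLp.inner_apply] at this
    rw [Matrix.mul_apply, Matrix.one_apply, ← this]
    refine Finset.sum_congr rfl fun i _ => ?_
    simp [Matrix.star_apply, mul_comm]
  · ext i k
    rw [realDiag, Matrix.mul_diagonal, Matrix.of_apply]
    by_cases hk : μ k = 0
    · have h0 := hent k k
      rw [if_pos rfl, hk] at h0
      have h1 : ∑ i, ‖N i k‖ ^ 2 = 0 := by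
        apply Complex.ofReal_injective
        rw [← h0]; simp [Complex.conj_mul']
      have h2 := (Finset.sum_eq_zero_iff_of_nonneg (fun i _ => by positivity)).1 h1 i
        (Finset.mem_univ i)
      have : N i k = 0 := by simpa using h2
      rw [this, hk]; simp
    · rw [hb k hk]
      have : (Real.sqrt (μ k) : ℂ) ≠ 0 := by
        exact_mod_cast (Real.sqrt_pos.2 (lt_of_le_of_ne (hμ k) (Ne.symm hk))).ne'
      simp [hv, this]

lemma conj_smul_sub_eq {U V : Matrix ι ι ℂ} (hV : star V * V = 1) {a b g : ι → ℝ} {c : ℝ}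
    (hg : ∀ j, g j * b j * g j = g j) :
    (star U * V * realDiag g * star V) * (c • (V * realDiag b * star V) -
      U * realDiag a * star U) * star (star U * V * realDiag g * star V) =
    c • (star U * V * realDiag g * star (star U * V)) -
      (star U * V * realDiag g * star (star U * V)) * realDiag a *
        star (star U * V * realDiag g * star (star U * V)) := by
  have h : realDiag g * realDiag b * realDiag g = realDiag g := by
    rw [realDiag_mul, realDiag_mul]
    congr 1
    exact funext hg
  rw [Matrix.mul_sub, Matrix.sub_mul, Matrix.mul_smul, Matrix.smul_mul]
  simp only [star_mul, star_star, star_realDiag]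
  refine congrArg₂ _ (congrArg _ ?_) ?_
  · calc _ = star U * V * realDiag g * (star V * V) * realDiag b * (star V * V) *
            realDiag g * (star V * U) := by simp only [Matrix.mul_assoc]
      _ = star U * V * (realDiag g * realDiag b * realDiag g) * (star V * U) := by
          rw [hV]; simp only [Matrix.mul_assoc, Matrix.one_mul]
      _ = _ := by rw [h]
  · simp only [Matrix.mul_assoc]

section Pair

variable {A B : Matrix ι ι ℂ} (D : SpectralData A) (D' : SpectralData B)

/-- The matrix of overlaps of two eigenbases. -/
def overlap : Matrix ι ι ℂ := star D.U * D'.U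

lemma overlap_mem : overlap D D' ∈ Matrix.unitaryGroup ι ℂ :=
  mul_mem (Unitary.star_mem D.mem_unitary) D'.mem_unitary

lemma suppLE_iff_overlap :
    suppLE A B ↔ ∀ i j, D'.eig j = 0 → D.eig i ≠ 0 → overlap D D' i j = 0 := by
  have hU := Matrix.mem_unitaryGroup_iff'.1 D.mem_unitary
  have hV := Matrix.mem_unitaryGroup_iff'.1 D'.mem_unitary
  have hV' := Matrix.mem_unitaryGroup_iff.1 D'.mem_unitary
  constructor
  · intro h i j hj hi
    have hB : B * D'.U = D'.U * realDiag D'.eig := by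
      refine (congrArg (fun X => X * D'.U) D'.eq).trans ?_
      rw [Matrix.mul_assoc, hV, Matrix.mul_one]
    have h1 : B.mulVec (fun k => D'.U k j) = 0 := by
      ext k
      have := congrFun (congrFun hB k) j
      rw [realDiag, Matrix.mul_diagonal, hj, Complex.ofReal_zero, mul_zero] at this
      exact this
    have h2 := h _ h1
    have h3 : star D.U * (A * D'.U) = realDiag D.eig * overlap D D' := by
      refine (congrArg (fun X => star D.U * (X * D'.U)) D.eq).trans ?_
      calc _ = (star D.U * D.U) * realDiag D.eig * (star D.U * D'.U) := by
            simp only [Matrix.mul_assoc]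
        _ = _ := by rw [hU, Matrix.one_mul, overlap]
    have h4 := congrFun (congrFun h3 i) j
    rw [realDiag, Matrix.diagonal_mul, Matrix.mul_apply] at h4
    have h5 : ∀ k, (A * D'.U) k j = 0 := fun k => congrFun h2 k
    simp only [h5, mul_zero, Finset.sum_const_zero] at h4
    have hi' : (D.eig i : ℂ) ≠ 0 := by exact_mod_cast hi
    exact (mul_eq_zero.1 h4.symm).resolve_left hi'
  · intro h v hv
    set w := (star D'.U).mulVec v with hw
    have hvw : v = D'.U.mulVec w := by
      rw [hw, Matrix.mulVec_mulVec, hV', Matrix.one_mulVec]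
    have h1 : (realDiag D'.eig).mulVec w = 0 := by
      have : (star D'.U).mulVec (B.mulVec v) = (realDiag D'.eig).mulVec w := by
        rw [hw, Matrix.mulVec_mulVec, Matrix.mulVec_mulVec]
        refine (congrArg (fun X => (star D'.U * X).mulVec v) D'.eq).trans ?_
        rw [← Matrix.mul_assoc, ← Matrix.mul_assoc, hV, Matrix.one_mul]
      rw [← this, hv, Matrix.mulVec_zero]
    have h2 : ∀ j, (D'.eig j : ℂ) * w j = 0 := fun j => by
      have := congrFun h1 j
      rwa [realDiag, Matrix.mulVec_diagonal] at this
    have h3 : A.mulVec v = D.U.mulVec ((realDiag D.eig).mulVec ((overlap D D').mulVec w)) := by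
      rw [hvw]
      refine (congrArg (fun X => X.mulVec (D'.U.mulVec w)) D.eq).trans ?_
      simp only [Matrix.mulVec_mulVec, overlap, Matrix.mul_assoc]
    have h4 : (realDiag D.eig).mulVec ((overlap D D').mulVec w) = 0 := by
      ext i
      rw [realDiag, Matrix.mulVec_diagonal, Pi.zero_apply, Matrix.mulVec, dotProduct,
        Finset.mul_sum]
      refine Finset.sum_eq_zero fun j _ => ?_
      by_cases hi : D.eig i = 0
      · simp [hi]
      by_cases hj : D'.eig j = 0
      · simp [h i j hj hi]
      · have : (D'.eig j : ℂ) ≠ 0 := by exact_mod_cast hj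
        rw [(mul_eq_zero.1 (h2 j)).resolve_left this]; simp
    rw [h3, h4, Matrix.mulVec_zero]

lemma reTrace_mul_matLog_sub :
    reTrace (A * (matLog A - matLog B)) = ∑ i, ∑ j, ‖overlap D D' i j‖ ^ 2 *
      (D.eig i * (Real.log (D.eig i) - Real.log (D'.eig j))) := by
  have hU := Matrix.mem_unitaryGroup_iff'.1 D.mem_unitary
  have h1 : reTrace (A * matLog A) = ∑ i, ∑ j, ‖overlap D D' i j‖ ^ 2 *
      (D.eig i * Real.log (D.eig i)) := by
    have : A * matLog A =
        D.U * realDiag (fun i => D.eig i * Real.log (D.eig i)) * star D.U := by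
      rw [matLog, D.hermApply_eq]
      refine (congrArg (fun X => X * (D.U * realDiag (fun i => Real.log (D.eig i)) *
        star D.U)) D.eq).trans ?_
      calc _ = D.U * realDiag D.eig * (star D.U * D.U) *
              realDiag (fun i => Real.log (D.eig i)) * star D.U := by
            simp only [Matrix.mul_assoc]
        _ = _ := by rw [hU, Matrix.mul_one, Matrix.mul_assoc D.U, realDiag_mul]
    rw [this, reTrace_conj_realDiag D.mem_unitary]
    refine Finset.sum_congr rfl fun i _ => ?_
    rw [← Finset.sum_mul, unitary_row_sum (overlap_mem D D'), one_mul]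
  have h2 : reTrace (A * matLog B) = ∑ i, ∑ j, ‖overlap D D' i j‖ ^ 2 *
      (D.eig i * Real.log (D'.eig j)) := by
    have : (A * matLog B).trace = (realDiag D.eig * (overlap D D' *
        realDiag (fun i => Real.log (D'.eig i)) * star (overlap D D'))).trace := by
      rw [matLog, D'.hermApply_eq]
      refine (congrArg (fun X => (X * (D'.U * realDiag (fun i => Real.log (D'.eig i)) *
        star D'.U)).trace) D.eq).trans ?_
      rw [overlap, star_mul, star_star, Matrix.mul_assoc, Matrix.mul_assoc, Matrix.trace_mul_comm]
      simp only [Matrix.mul_assoc]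
    rw [reTrace, this, Matrix.trace, Complex.re_sum]
    refine Finset.sum_congr rfl fun i _ => ?_
    rw [Matrix.diag_apply, realDiag, Matrix.diagonal_mul, Matrix.mul_apply, Complex.re_ofReal_mul,
      Complex.re_sum, Finset.mul_sum]
    refine Finset.sum_congr rfl fun j _ => ?_
    have : (overlap D D' * realDiag fun i => Real.log (D'.eig i)) i j *
        star (overlap D D') j i = ((‖overlap D D' i j‖ ^ 2 * Real.log (D'.eig j) : ℝ) : ℂ) := by
      push_cast
      rw [← Complex.mul_conj', realDiag, Matrix.mul_diagonal, Matrix.star_apply, RCLike.star_def]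
      ring
    rw [this, Complex.ofReal_re]
    ring
  have h3 : reTrace (A * (matLog A - matLog B)) =
      reTrace (A * matLog A) - reTrace (A * matLog B) := by
    simp [reTrace, Matrix.mul_sub, Matrix.trace_sub]
  rw [h3, h1, h2, ← Finset.sum_sub_distrib]
  refine Finset.sum_congr rfl fun i _ => ?_
  rw [← Finset.sum_sub_distrib]
  exact Finset.sum_congr rfl fun j _ => by ring

lemma eig_mul_sum_overlap_le {c : ℝ} (hc : 0 ≤ c) (h : loewnerLE A (c • B)) (i : ι) :
    D.eig i * ∑ j, ‖overlap D D' i j‖ ^ 2 * suppPow (D'.eig j) (-1) ≤ c := by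
  set C := overlap D D' with hC
  set g : ι → ℝ := fun j => suppPow (D'.eig j) (-1) with hg
  have hgn : ∀ j, 0 ≤ g j := fun j => suppPow_nonneg (D'.eig_nonneg j) _
  set K := C * realDiag g * star C with hK
  have hV := Matrix.mem_unitaryGroup_iff'.1 D'.mem_unitary
  have hN := h.mul_mul_conjTranspose_same (C * realDiag g * star D'.U)
  rw [← Matrix.star_eq_conjTranspose] at hN
  have e1 : (C * realDiag g * star D'.U) * (c • B - A) * star (C * realDiag g * star D'.U) =
      c • (C * realDiag g * star C) - K * realDiag D.eig * star K :=
    (congrArg₂ (fun X Y => (C * realDiag g * star D'.U) * (c • X - Y) *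
      star (C * realDiag g * star D'.U)) D'.eq D.eq).trans
      (conj_smul_sub_eq hV fun j => by
        have e := suppPow_mul (D'.eig_nonneg j) (-1) 1
        have e' := suppPow_mul (D'.eig_nonneg j) (-1 + 1) (-1)
        rw [suppPow_one] at e
        rw [← e] at e'
        rw [hg]
        dsimp only
        rw [e']
        norm_num)
  rw [e1] at hN
  have hd := (Complex.le_def.1 (hN.diag_nonneg (i := i))).1
  set β := ∑ j, ‖C i j‖ ^ 2 * g j with hβ
  have hβn : 0 ≤ β := Finset.sum_nonneg fun j _ => mul_nonneg (by positivity) (hgn j)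
  have e2 : (C * realDiag g * star C) i i = (β : ℂ) := by
    rw [Matrix.mul_apply, hβ]
    push_cast
    refine Finset.sum_congr rfl fun j _ => ?_
    rw [← Complex.mul_conj', realDiag, Matrix.mul_diagonal, Matrix.star_apply, RCLike.star_def]
    ring
  have e3 : (K * realDiag D.eig * star K) i i = ((∑ k, ‖K i k‖ ^ 2 * D.eig k : ℝ) : ℂ) := by
    rw [Matrix.mul_apply]
    push_cast
    refine Finset.sum_congr rfl fun j _ => ?_
    rw [← Complex.mul_conj', realDiag, Matrix.mul_diagonal, Matrix.star_apply, RCLike.star_def]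
    ring
  rw [Matrix.sub_apply, Matrix.smul_apply, e2, e3] at hd
  simp only [Complex.zero_re, Complex.sub_re, Complex.ofReal_re, Complex.smul_re,
    smul_eq_mul, sub_nonneg] at hd
  have h4 : β ^ 2 * D.eig i ≤ c * β := by
    refine le_trans ?_ hd
    have : β ^ 2 * D.eig i = ‖K i i‖ ^ 2 * D.eig i := by
      rw [hK, e2, Complex.norm_real, Real.norm_of_nonneg hβn]
    rw [this]
    exact Finset.single_le_sum (f := fun k => ‖K i k‖ ^ 2 * D.eig k)
      (fun k _ => mul_nonneg (by positivity) (D.eig_nonneg k)) (Finset.mem_univ i)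
  rcases hβn.eq_or_lt with h0 | hpos
  · rw [← h0, mul_zero]; exact hc
  · nlinarith

/-- The trace quantity `Q_{α,z}` as a power sum of singular values. -/
lemma exists_Qaz_eq (α : ℝ) {z : ℝ} (hz : 0 < z) :
    ∃ P ∈ Matrix.unitaryGroup ι ℂ, ∃ R ∈ Matrix.unitaryGroup ι ℂ, ∃ s : ι → ℝ,
      (∀ k, 0 ≤ s k) ∧
      P * realDiag (fun i => suppPow (D.eig i) (α / (2 * z))) * overlap D D' *
        realDiag (fun j => suppPow (D'.eig j) ((1 - α) / (2 * z))) * R = realDiag s ∧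
      Qaz α z A B = ∑ k, s k ^ (2 * z) := by
  have hU := Matrix.mem_unitaryGroup_iff'.1 D.mem_unitary
  set x : ι → ℝ := fun i => suppPow (D.eig i) (α / (2 * z)) with hx
  set G := matPow A (α / (2 * z)) * matPow B ((1 - α) / (2 * z)) with hG
  have hsA : star (matPow A (α / (2 * z))) = matPow A (α / (2 * z)) := by
    rw [D.matPow_eq]; simp only [star_mul, star_star, star_realDiag, Matrix.mul_assoc]
  have hsB : star (matPow B ((1 - α) / (2 * z))) = matPow B ((1 - α) / (2 * z)) := by
    rw [D'.matPow_eq]; simp only [star_mul, star_star, star_realDiag, Matrix.mul_assoc]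
  have hAA : matPow A (α / (2 * z)) * matPow A (α / (2 * z)) = matPow A (α / z) := by
    rw [D.matPow_eq, D.matPow_eq]
    calc _ = D.U * realDiag x * (star D.U * D.U) * realDiag x * star D.U := by
            simp only [Matrix.mul_assoc, hx]
      _ = _ := by
        rw [hU, Matrix.mul_one, Matrix.mul_assoc D.U, realDiag_mul, hx]
        congr 3; ext i
        rw [suppPow_mul (D.eig_nonneg i)]
        congr 1; field_simp; ring
  have hM : matPow B ((1 - α) / (2 * z)) * matPow A (α / z) * matPow B ((1 - α) / (2 * z)) =
      star G * G := by
    rw [hG, star_mul, hsA, hsB, ← hAA]; simp only [Matrix.mul_assoc]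
  have hMp : (star G * G).PosSemidef := by
    rw [Matrix.star_eq_conjTranspose]; exact Matrix.posSemidef_conjTranspose_mul_self G
  obtain ⟨DM⟩ := exists_spectralData hMp
  have hVM := Matrix.mem_unitaryGroup_iff'.1 DM.mem_unitary
  obtain ⟨W, hW, hGW⟩ := exists_unitary_mul_realDiag (N := G * DM.U) DM.eig_nonneg (by
    rw [star_mul]
    calc star DM.U * star G * (G * DM.U) = star DM.U * (star G * G) * DM.U := by
          simp only [Matrix.mul_assoc]
      _ = star DM.U * (DM.U * realDiag DM.eig * star DM.U) * DM.U := by rw [← DM.eq]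
      _ = (star DM.U * DM.U) * realDiag DM.eig * (star DM.U * DM.U) := by
          simp only [Matrix.mul_assoc]
      _ = _ := by rw [hVM, Matrix.one_mul, Matrix.mul_one])
  refine ⟨star W * D.U, mul_mem (Unitary.star_mem hW) D.mem_unitary, star D'.U * DM.U,
    mul_mem (Unitary.star_mem D'.mem_unitary) DM.mem_unitary,
    fun i => Real.sqrt (DM.eig i), fun k => Real.sqrt_nonneg _, ?_, ?_⟩
  · have : star W * (G * DM.U) = realDiag fun i => Real.sqrt (DM.eig i) := by
      rw [hGW, ← Matrix.mul_assoc, Matrix.mem_unitaryGroup_iff'.1 hW, Matrix.one_mul]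
    have hGe : G = D.U * realDiag x * star D.U *
        (D'.U * realDiag (fun j => suppPow (D'.eig j) ((1 - α) / (2 * z))) * star D'.U) := by
      rw [hG, D.matPow_eq, D'.matPow_eq]
    refine Eq.trans ?_ ((congrArg (fun X => star W * (X * DM.U)) hGe).symm.trans this)
    simp only [Matrix.mul_assoc, overlap]
  · rw [Qaz, hM, DM.matPow_eq, reTrace_conj_realDiag DM.mem_unitary]
    refine Finset.sum_congr rfl fun k _ => ?_
    dsimp only
    rw [suppPow_eq_rpow hz.ne', Real.sqrt_eq_rpow, ← Real.rpow_mul (DM.eig_nonneg k)]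
    congr 1; ring

end Pair

lemma SpectralData.reTrace_nonneg {A : Matrix ι ι ℂ} (D : SpectralData A) : 0 ≤ reTrace A := by
  rw [D.reTrace_eq]
  exact Finset.sum_nonneg fun i _ => D.eig_nonneg i

lemma PSDne.reTrace_pos {A : Matrix ι ι ℂ} (hA : PSDne A) : 0 < reTrace A := by
  obtain ⟨D⟩ := exists_spectralData hA.1
  refine lt_of_le_of_ne D.reTrace_nonneg fun h => hA.2 ?_
  rw [D.reTrace_eq] at h
  have h0 : D.eig = fun _ => 0 := funext fun i =>
    (Finset.sum_eq_zero_iff_of_nonneg fun i _ => D.eig_nonneg i).1 h.symm i (Finset.mem_univ i)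
  rw [D.eq, h0]
  simp [realDiag]

lemma exp_le_one_add_add_sq_mul (x : ℝ) : Real.exp x ≤ 1 + x + x ^ 2 * Real.exp |x| := by
  have h1 : Real.exp x * (1 - x) ≤ 1 := by
    have := mul_le_mul_of_nonneg_left (Real.one_sub_le_exp_neg x) (Real.exp_pos x).le
    rwa [← Real.exp_add, add_neg_cancel, Real.exp_zero] at this
  have h2 := Real.add_one_le_exp x
  rcases le_total 0 x with hx | hx
  · rw [abs_of_nonneg hx]
    nlinarith [mul_le_mul_of_nonneg_left h1 hx]
  · have h3 : 1 ≤ Real.exp |x| := Real.one_le_exp (abs_nonneg x)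
    nlinarith [mul_le_mul_of_nonneg_left h3 (sq_nonneg x), mul_nonneg (neg_nonneg.2 hx)
      (sub_nonneg.2 h2)]

lemma exp_mul_le_of_le_half (T : ℝ) {s : ℝ} (h0 : 0 ≤ s) (h1 : s ≤ 1 / 2) :
    Real.exp (s * T) ≤ 1 + s * T + 8 * s ^ 2 * (Real.exp T + Real.exp (-T)) := by
  have e1 := exp_le_one_add_add_sq_mul (s * T)
  have e2 : Real.exp |s * T| ≤ Real.exp (|T| / 2) := by
    rw [Real.exp_le_exp, abs_mul, abs_of_nonneg h0]
    nlinarith [abs_nonneg T]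
  have e3 : T ^ 2 ≤ 8 * Real.exp (|T| / 2) := by
    have := Real.quadratic_le_exp_of_nonneg (x := |T| / 2) (by positivity)
    nlinarith [sq_abs T, abs_nonneg T]
  have e4 : Real.exp (|T| / 2) * Real.exp (|T| / 2) ≤ Real.exp T + Real.exp (-T) := by
    rw [← Real.exp_add, add_halves]
    rcases abs_cases T with ⟨h, _⟩ | ⟨h, _⟩ <;> rw [h]
    · linarith [Real.exp_pos (-T)]
    · linarith [Real.exp_pos T]
  have e5 : T ^ 2 * Real.exp |s * T| ≤ 8 * (Real.exp T + Real.exp (-T)) := by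
    calc _ ≤ (8 * Real.exp (|T| / 2)) * Real.exp (|T| / 2) :=
          mul_le_mul e3 e2 (Real.exp_pos _).le (by positivity)
      _ ≤ _ := by linarith
  calc _ ≤ _ := e1
    _ = 1 + s * T + s ^ 2 * (T ^ 2 * Real.exp |s * T|) := by ring
    _ ≤ 1 + s * T + s ^ 2 * (8 * (Real.exp T + Real.exp (-T))) := by gcongr
    _ = _ := by ring

section Bounds

variable {A B : Matrix ι ι ℂ} (D : SpectralData A) (D' : SpectralData B)

/-- The Petz-type quasi-entropy `Tr (A ^ (1 + t) * B ^ (-t))` in coordinates of eigenbases. -/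
def petzSum (t : ℝ) : ℝ := ∑ i, ∑ j, ‖overlap D D' i j‖ ^ 2 *
  (D.eig i * (suppPow (D.eig i) t * suppPow (D'.eig j) (-t)))

lemma petzSum_nonneg (t : ℝ) : 0 ≤ petzSum D D' t :=
  Finset.sum_nonneg fun i _ => Finset.sum_nonneg fun j _ => mul_nonneg (by positivity)
    (mul_nonneg (D.eig_nonneg i) (mul_nonneg (suppPow_nonneg (D.eig_nonneg i) _)
      (suppPow_nonneg (D'.eig_nonneg j) _)))

lemma sum_overlap_mul_eig : ∑ i, ∑ j, ‖overlap D D' i j‖ ^ 2 * D.eig i = reTrace A := by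
  rw [D.reTrace_eq]
  refine Finset.sum_congr rfl fun i _ => ?_
  rw [← Finset.sum_mul, unitary_row_sum (overlap_mem D D'), one_mul]

lemma Qaz_le_of_lt_one (α : ℝ) {z : ℝ} (hz : 1 / 2 < z) (hz1 : z < 1) :
    Qaz α z A B ≤ reTrace A ^ (1 - z) * petzSum D D' ((α - 1) / z) ^ z := by
  obtain ⟨P, hP, R, hR, s, hs, h, hQ⟩ := exists_Qaz_eq D D' α (z := z) (by linarith)
  rw [hQ, D.reTrace_eq]
  refine (sum_singular_rpow_le_of_lt_one hP hR D.eig_nonneg hs hz hz1 h).trans_eq ?_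
  congr 2
  refine Finset.sum_congr rfl fun i _ => Finset.sum_congr rfl fun j _ => ?_
  have e := suppPow_mul (D.eig_nonneg i) 1 ((α - 1) / z)
  rw [suppPow_one] at e
  rw [suppPow_sq (D'.eig_nonneg j), ← mul_assoc (D.eig i), e]
  have hz0 : z ≠ 0 := by linarith
  congr 3
  · field_simp; ring
  · field_simp; ring

lemma suppPow_suppPow {t : ℝ} (ht : 0 ≤ t) (x y : ℝ) :
    suppPow (suppPow t x) y = suppPow t (x * y) := by
  rcases ht.eq_or_lt with rfl | ht
  · simp [suppPow]
  · have : t ^ x ≠ 0 := (Real.rpow_pos_of_pos ht x).ne'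
    simp [suppPow, ht.ne', this, Real.rpow_mul ht.le]

lemma Qaz_le_of_one_le (α : ℝ) {z : ℝ} (hz : 1 ≤ z) : Qaz α z A B ≤ petzSum D D' (α - 1) := by
  have hz0 : 0 < z := by linarith
  obtain ⟨P, hP, R, hR, s, hs, h, hQ⟩ := exists_Qaz_eq D D' α hz0
  have e1 : ∀ i, suppPow (D.eig i) (α / (2 * z)) =
      suppPow (suppPow (D.eig i) (α / 2)) (1 / z) := fun i => by
    rw [suppPow_suppPow (D.eig_nonneg i)]; congr 1; field_simp
  have e2 : ∀ j, suppPow (D'.eig j) ((1 - α) / (2 * z)) =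
      suppPow (suppPow (D'.eig j) ((1 - α) / 2)) (1 / z) := fun i => by
    rw [suppPow_suppPow (D'.eig_nonneg i)]; congr 1; field_simp
  simp only [e1, e2] at h
  have := sum_singular_rpow_le hP (overlap_mem D D') hR
    (fun i => suppPow_nonneg (D.eig_nonneg i) _) (fun i => suppPow_nonneg (D'.eig_nonneg i) _)
    hs (r := 1 / z) (by positivity) (by rw [div_le_one hz0]; exact hz) h
  rw [div_div_eq_mul_div, div_one] at this
  rw [hQ]
  refine this.trans_eq ?_
  refine Finset.sum_congr rfl fun i _ => Finset.sum_congr rfl fun j _ => ?_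
  have e := suppPow_mul (D.eig_nonneg i) 1 (α - 1)
  rw [suppPow_one] at e
  rw [suppPow_sq (D'.eig_nonneg j), suppPow_sq (D.eig_nonneg i), ← mul_assoc (D.eig i), e]
  congr 3 <;> ring

lemma Qaz_nonneg {A B : Matrix ι ι ℂ} (D : SpectralData A) (D' : SpectralData B) (α : ℝ) {z : ℝ} (hz : 0 < z) : 0 ≤ Qaz α z A B := by
  obtain ⟨P, hP, R, hR, s, hs, h, hQ⟩ := exists_Qaz_eq D D' α hz
  rw [hQ]
  exact Finset.sum_nonneg fun k _ => Real.rpow_nonneg (hs k) _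

lemma petzSum_le_Qaz_rpow (α : ℝ) {z : ℝ} (hz : 1 / 2 < z) :
    petzSum D D' ((α - 1) / (2 * z)) ≤
      reTrace A ^ (1 - 1 / (2 * z)) * Qaz α z A B ^ (1 / (2 * z)) := by
  obtain ⟨P, hP, R, hR, s, hs, h, hQ⟩ := exists_Qaz_eq D D' α (z := z) (by linarith)
  rw [hQ, D.reTrace_eq]
  refine le_trans (le_of_eq ?_)
    (le_sum_singular_rpow hP (overlap_mem D D') hR D.eig_nonneg hs hz h)
  refine Finset.sum_congr rfl fun i _ => Finset.sum_congr rfl fun j _ => ?_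
  have e1 : D.eig i ^ (1 - 1 / (2 * z)) = suppPow (D.eig i) (1 - 1 / (2 * z)) := by
    refine (suppPow_eq_rpow ?_ _).symm
    have : 1 / (2 * z) < 1 := by rw [div_lt_one (by linarith)]; linarith
    linarith
  have e := suppPow_mul (D.eig_nonneg i) 1 ((α - 1) / (2 * z))
  rw [suppPow_one] at e
  rw [← mul_assoc (D.eig i), e, e1, suppPow_mul (D.eig_nonneg i)]
  have hz0 : z ≠ 0 := by linarith
  congr 3
  · field_simp; ring
  · field_simp; ring

lemma overlap_mul_suppPow (hAB : suppLE A B) (t : ℝ) (i j : ι) : ‖overlap D D' i j‖ ^ 2 *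
    (D.eig i * (suppPow (D.eig i) t * suppPow (D'.eig j) (-t))) =
    ‖overlap D D' i j‖ ^ 2 * D.eig i *
      Real.exp (t * (Real.log (D.eig i) - Real.log (D'.eig j))) := by
  rw [suppLE_iff_overlap D D'] at hAB
  by_cases hi : D.eig i = 0
  · simp [hi]
  by_cases hj : D'.eig j = 0
  · simp [hAB i j hj hi]
  rw [suppPow_eq_exp (lt_of_le_of_ne (D.eig_nonneg i) (Ne.symm hi)),
    suppPow_eq_exp (lt_of_le_of_ne (D'.eig_nonneg j) (Ne.symm hj)), ← Real.exp_add, mul_assoc]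
  congr 4; ring

lemma petzSum_eq (hAB : suppLE A B) (t : ℝ) : petzSum D D' t = ∑ i, ∑ j,
    ‖overlap D D' i j‖ ^ 2 * D.eig i *
      Real.exp (t * (Real.log (D.eig i) - Real.log (D'.eig j))) :=
  Finset.sum_congr rfl fun i _ => Finset.sum_congr rfl fun j _ => overlap_mul_suppPow D D' hAB t i j

/-- The real number underlying the Umegaki relative entropy. -/
def umegaki (A B : Matrix ι ι ℂ) : ℝ := (reTrace A)⁻¹ * reTrace (A * (matLog A - matLog B))

lemma sum_overlap_mul_log (hA : 0 < reTrace A) : ∑ i, ∑ j, ‖overlap D D' i j‖ ^ 2 * D.eig i *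
    (Real.log (D.eig i) - Real.log (D'.eig j)) = reTrace A * umegaki A B := by
  rw [umegaki, mul_inv_cancel_left₀ hA.ne', reTrace_mul_matLog_sub D D']
  simp only [mul_assoc]

lemma mul_exp_le_petzSum (hAB : suppLE A B) (hA : 0 < reTrace A) (t : ℝ) :
    reTrace A * Real.exp (t * umegaki A B) ≤ petzSum D D' t := by
  set u := umegaki A B with hu
  have h1 : ∑ i, ∑ j, ‖overlap D D' i j‖ ^ 2 * D.eig i * (Real.exp (t * u) * (1 - t * u) +
      Real.exp (t * u) * t * (Real.log (D.eig i) - Real.log (D'.eig j))) =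
      reTrace A * Real.exp (t * u) := by
    have e : ∀ i j, ‖overlap D D' i j‖ ^ 2 * D.eig i * (Real.exp (t * u) * (1 - t * u) +
        Real.exp (t * u) * t * (Real.log (D.eig i) - Real.log (D'.eig j))) =
        Real.exp (t * u) * (1 - t * u) * (‖overlap D D' i j‖ ^ 2 * D.eig i) +
        Real.exp (t * u) * t * (‖overlap D D' i j‖ ^ 2 * D.eig i *
          (Real.log (D.eig i) - Real.log (D'.eig j))) := fun i j => by ring
    simp only [e, Finset.sum_add_distrib, ← Finset.mul_sum]
    rw [sum_overlap_mul_eig, sum_overlap_mul_log D D' hA, ← hu]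
    ring
  rw [petzSum_eq D D' hAB, ← h1]
  refine Finset.sum_le_sum fun i _ => Finset.sum_le_sum fun j _ =>
    mul_le_mul_of_nonneg_left ?_ (mul_nonneg (by positivity) (D.eig_nonneg i))
  set T := Real.log (D.eig i) - Real.log (D'.eig j)
  have h2 := mul_le_mul_of_nonneg_left (Real.add_one_le_exp (t * T - t * u)) (Real.exp_pos (t * u)).le
  rw [← Real.exp_add, add_sub_cancel] at h2
  refine le_trans (le_of_eq ?_) h2
  ring

lemma mul_exp_le_Qaz {A B : Matrix ι ι ℂ} (D : SpectralData A) (D' : SpectralData B)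
    (hAB : suppLE A B) (hA : 0 < reTrace A) (α : ℝ) {z : ℝ} (hz : 1 / 2 < z) :
    reTrace A * Real.exp ((α - 1) * umegaki A B) ≤ Qaz α z A B := by
  have hz0 : 0 < z := by linarith
  have hQ := Qaz_nonneg D D' α hz0
  set v := 1 / (2 * z) with hv
  have hv0 : 0 < v := by positivity
  have hvz : v * (2 * z) = 1 := by rw [hv]; field_simp
  have h1 := (mul_exp_le_petzSum D D' hAB hA ((α - 1) / (2 * z))).trans
    (petzSum_le_Qaz_rpow D D' α hz)
  have h2 : reTrace A ^ v * Real.exp ((α - 1) / (2 * z) * umegaki A B) ≤ Qaz α z A B ^ v := by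
    refine le_of_mul_le_mul_left ?_ (Real.rpow_pos_of_pos hA (1 - v))
    rw [← mul_assoc, ← Real.rpow_add hA]
    rwa [sub_add_cancel, Real.rpow_one]
  have h3 := Real.rpow_le_rpow (by positivity) h2 (z := 2 * z) (by positivity)
  rw [Real.mul_rpow (by positivity) (Real.exp_pos _).le, ← Real.rpow_mul hA.le,
    ← Real.rpow_mul hQ, hvz, Real.rpow_one, Real.rpow_one, ← Real.exp_mul] at h3
  refine le_trans (le_of_eq ?_) h3
  congr 2
  field_simp

lemma petzSum_one_le {c : ℝ} (hc : 0 ≤ c) (h : loewnerLE A (c • B)) :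
    petzSum D D' 1 ≤ c * reTrace A := by
  rw [D.reTrace_eq, Finset.mul_sum]
  refine Finset.sum_le_sum fun i _ => ?_
  have := mul_le_mul_of_nonneg_right (eig_mul_sum_overlap_le D D' hc h i) (D.eig_nonneg i)
  refine le_trans (le_of_eq ?_) this
  rw [Finset.mul_sum, Finset.sum_mul]
  refine Finset.sum_congr rfl fun j _ => ?_
  rw [suppPow_one]; ring

lemma petzSum_neg_one_le : petzSum D D' (-1) ≤ reTrace B := by
  have : reTrace B = ∑ i, ∑ j, ‖overlap D D' i j‖ ^ 2 * D'.eig j := by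
    rw [D'.reTrace_eq, Finset.sum_comm]
    refine Finset.sum_congr rfl fun j _ => ?_
    rw [← Finset.sum_mul, unitary_col_sum (overlap_mem D D'), one_mul]
  rw [this]
  refine Finset.sum_le_sum fun i _ => Finset.sum_le_sum fun j _ =>
    mul_le_mul_of_nonneg_left ?_ (by positivity)
  have e := suppPow_mul (D.eig_nonneg i) 1 (-1)
  rw [suppPow_one, add_neg_cancel] at e
  rw [← mul_assoc, e, neg_neg, suppPow_one]
  refine mul_le_of_le_one_left (D'.eig_nonneg j) ?_
  unfold suppPow; split_ifs <;> simp

lemma petzSum_le (hAB : suppLE A B) (hA : 0 < reTrace A) {c K : ℝ} (hc : 0 ≤ c)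
    (h : loewnerLE A (c • B)) (hK : reTrace B ≤ K * reTrace A) {s : ℝ} (h0 : 0 ≤ s)
    (h1 : s ≤ 1 / 2) :
    petzSum D D' s ≤ reTrace A * (1 + s * umegaki A B + 8 * s ^ 2 * (c + K)) := by
  have e1 := petzSum_one_le D D' hc h
  have e2 := (petzSum_neg_one_le D D').trans hK
  have e3 : petzSum D D' s ≤ reTrace A + s * (reTrace A * umegaki A B) +
      8 * s ^ 2 * (petzSum D D' 1 + petzSum D D' (-1)) := by
    rw [← sum_overlap_mul_log D D' hA]
    conv_rhs => rw [← sum_overlap_mul_eig D D']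
    simp only [petzSum_eq D D' hAB, Finset.mul_sum, ← Finset.sum_add_distrib]
    refine Finset.sum_le_sum fun i _ => Finset.sum_le_sum fun j _ => ?_
    set T := Real.log (D.eig i) - Real.log (D'.eig j)
    have := mul_le_mul_of_nonneg_left (exp_mul_le_of_le_half T h0 h1)
      (mul_nonneg (sq_nonneg ‖overlap D D' i j‖) (D.eig_nonneg i))
    refine this.trans_eq ?_
    rw [one_mul, neg_one_mul]
    ring
  nlinarith [mul_le_mul_of_nonneg_left (add_le_add e1 e2) (by positivity : 0 ≤ 8 * s ^ 2)]

lemma continuous_petzSum : Continuous (petzSum D D') := by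
  unfold petzSum
  refine continuous_finsetSum _ fun i _ => continuous_finsetSum _ fun j _ =>
    continuous_const.mul (continuous_const.mul ((continuous_suppPow _).mul
      ((continuous_suppPow _).comp continuous_neg)))

lemma petzSum_zero_lt (hAB : ¬ suppLE A B) : petzSum D D' 0 < reTrace A := by
  rw [suppLE_iff_overlap D D'] at hAB
  push Not at hAB
  obtain ⟨i₀, j₀, hj, hi, hij⟩ := hAB
  rw [← sum_overlap_mul_eig D D']
  have hterm : ∀ i j, ‖overlap D D' i j‖ ^ 2 *
      (D.eig i * (suppPow (D.eig i) 0 * suppPow (D'.eig j) (-0))) ≤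
      ‖overlap D D' i j‖ ^ 2 * D.eig i := fun i j => by
    refine mul_le_mul_of_nonneg_left (mul_le_of_le_one_right (D.eig_nonneg i) ?_) (by positivity)
    unfold suppPow; split_ifs <;> simp
  refine Finset.sum_lt_sum (fun i _ => Finset.sum_le_sum fun j _ => hterm i j)
    ⟨i₀, Finset.mem_univ _, Finset.sum_lt_sum (fun j _ => hterm i₀ j) ⟨j₀, Finset.mem_univ _, ?_⟩⟩
  have h1 : 0 < D.eig i₀ := lt_of_le_of_ne (D.eig_nonneg _) (Ne.symm hi)
  have h2 : 0 < ‖overlap D D' i₀ j₀‖ := norm_pos_iff.2 hij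
  simp only [hj, suppPow, if_true, mul_zero]
  positivity

lemma hasDerivAt_petzSum_zero (hAB : suppLE A B) (hA : 0 < reTrace A) :
    HasDerivAt (petzSum D D') (reTrace A * umegaki A B) 0 := by
  have : petzSum D D' = fun t => ∑ i, ∑ j, ‖overlap D D' i j‖ ^ 2 * D.eig i *
      Real.exp (t * (Real.log (D.eig i) - Real.log (D'.eig j))) :=
    funext fun t => petzSum_eq D D' hAB t
  rw [this, ← sum_overlap_mul_log D D' hA]
  refine HasDerivAt.fun_sum fun i _ => HasDerivAt.fun_sum fun j _ => ?_
  set T := Real.log (D.eig i) - Real.log (D'.eig j)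
  have h := ((hasDerivAt_mul_const (x := (0 : ℝ)) T).exp).const_mul
    (‖overlap D D' i j‖ ^ 2 * D.eig i)
  simpa using h

lemma eventually_petzSum_lt (hA : 0 < reTrace A) {c : ℝ} (hc : (c : EReal) < DUm A B) :
    ∀ᶠ t in 𝓝[<] (0 : ℝ), petzSum D D' t < reTrace A * Real.exp (c * t) := by
  have hcont : Continuous fun t : ℝ => reTrace A * Real.exp (c * t) := by fun_prop
  by_cases hAB : suppLE A B
  · rw [DUm, if_pos hAB, EReal.coe_lt_coe_iff] at hc
    have hc' : c < umegaki A B := hc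
    have h1 : HasDerivAt (fun t : ℝ => reTrace A * Real.exp (c * t)) (reTrace A * c) 0 := by
      have := (((hasDerivAt_id (0 : ℝ)).const_mul c).exp).const_mul (reTrace A)
      simpa using this
    have h2 := (hasDerivAt_petzSum_zero D D' hAB hA).sub h1
    have h3 := (hasDerivAt_iff_tendsto_slope.1 h2).mono_left
      (nhdsWithin_mono (0 : ℝ) fun x (hx : x < 0) => ne_of_lt hx)
    have h4 : 0 < reTrace A * umegaki A B - reTrace A * c := by
      rw [← mul_sub]; exact mul_pos hA (sub_pos.2 hc')
    have h0 : petzSum D D' 0 = reTrace A := by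
      rw [petzSum_eq D D' hAB, ← sum_overlap_mul_eig D D']; simp
    filter_upwards [h3.eventually (lt_mem_nhds h4), self_mem_nhdsWithin] with t ht ht0
    have ht0' : t < 0 := ht0
    simp only [slope_def_field, Pi.sub_apply, h0, mul_zero, Real.exp_zero, mul_one, sub_self,
      sub_zero] at ht
    by_contra hcon
    exact absurd ht (not_lt.2 (div_nonpos_of_nonneg_of_nonpos (by linarith) ht0'.le))
  · refine mem_nhdsWithin_of_mem_nhds ?_
    exact (continuous_petzSum D D').continuousAt.eventually_lt hcont.continuousAt
      (by simpa using petzSum_zero_lt D D' hAB)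

end Bounds

lemma DUm_le_Daz {A B : Matrix ι ι ℂ} (hA : PSDne A) (hB : B.PosSemidef) {α z : ℝ} (hα : 1 < α)
    (hz : 1 / 2 < z) : DUm A B ≤ Daz α z A B := by
  obtain ⟨D⟩ := exists_spectralData hA.1
  obtain ⟨D'⟩ := exists_spectralData hB
  have hA0 := hA.reTrace_pos
  rw [Daz]
  split_ifs with h
  · have hAB := h.1.resolve_right (not_lt.2 hα.le)
    have hQ := mul_exp_le_Qaz D D' hAB hA0 α hz
    have hl := Real.log_le_log (by positivity) hQ
    rw [Real.log_mul hA0.ne' (Real.exp_pos _).ne', Real.log_exp] at hl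
    rw [DUm, if_pos hAB, EReal.coe_le_coe_iff, ← umegaki, le_inv_mul_iff₀ (sub_pos.2 hα)]
    linarith
  · exact le_top

lemma Daz_le_DUm {A B : Matrix ι ι ℂ} (hA : PSDne A) (hB : B.PosSemidef) {α z : ℝ} (hα : α < 1)
    (hz : 1 / 2 < z) : Daz α z A B ≤ DUm A B := by
  obtain ⟨D⟩ := exists_spectralData hA.1
  obtain ⟨D'⟩ := exists_spectralData hB
  have hA0 := hA.reTrace_pos
  rw [DUm]
  split_ifs with hAB
  · have hQ := mul_exp_le_Qaz D D' hAB hA0 α hz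
    have hl := Real.log_le_log (by positivity) hQ
    rw [Real.log_mul hA0.ne' (Real.exp_pos _).ne', Real.log_exp] at hl
    have hQ0 : 0 < Qaz α z A B := lt_of_lt_of_le (by positivity) hQ
    rw [Daz, if_pos ⟨Or.inl hAB, hQ0.ne'⟩, EReal.coe_le_coe_iff, ← umegaki,
      ← div_eq_inv_mul, div_le_iff_of_neg (sub_neg.2 hα)]
    linarith
  · exact le_top

lemma Daz_le_add {A B : Matrix ι ι ℂ} (hA : PSDne A) (hB : B.PosSemidef) (hAB : suppLE A B)
    {c K : ℝ} (hc : 0 ≤ c) (h : loewnerLE A (c • B)) (hK : reTrace B ≤ K * reTrace A)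
    {α z : ℝ} (hα : 1 < α) (hα' : α ≤ 3 / 2) (hz : 1 ≤ z) :
    Daz α z A B ≤ DUm A B + ((8 * (c + K) * (α - 1) : ℝ) : EReal) := by
  obtain ⟨D⟩ := exists_spectralData hA.1
  obtain ⟨D'⟩ := exists_spectralData hB
  have hA0 := hA.reTrace_pos
  have hQ := mul_exp_le_Qaz D D' hAB hA0 α (z := z) (by linarith)
  have hQ0 : 0 < Qaz α z A B := lt_of_lt_of_le (by positivity) hQ
  have hQ' := (Qaz_le_of_one_le D D' α hz).trans
    (petzSum_le D D' hAB hA0 hc h hK (s := α - 1) (by linarith) (by linarith))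
  rw [Daz, if_pos ⟨Or.inl hAB, hQ0.ne'⟩, DUm, if_pos hAB, ← EReal.coe_add, EReal.coe_le_coe_iff,
    ← umegaki, inv_mul_le_iff₀ (sub_pos.2 hα), ← Real.log_div hQ0.ne' hA0.ne']
  refine (Real.log_le_sub_one_of_pos (by positivity)).trans ?_
  rw [sub_le_iff_le_add, div_le_iff₀ hA0]
  linarith

lemma exists_lt_Daz {A B : Matrix ι ι ℂ} (hA : PSDne A) (hB : B.PosSemidef) {c : ℝ}
    (hc : (c : EReal) < DUm A B) :
    ∀ᶠ α in 𝓝[<] (1 : ℝ), ∀ z, α ≤ z → (c : EReal) < Daz α z A B := by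
  obtain ⟨D⟩ := exists_spectralData hA.1
  obtain ⟨D'⟩ := exists_spectralData hB
  have hA0 := hA.reTrace_pos
  obtain ⟨l, hl, hlt⟩ := (mem_nhdsLT_iff_exists_Ioo_subset).1 (eventually_petzSum_lt D D' hA0 hc)
  have hl' : l < 0 := hl
  have hev : ∀ᶠ α in 𝓝[<] (1 : ℝ), α < 1 ∧ max (1 / 2) (1 + l / 2) < α := by
    filter_upwards [self_mem_nhdsWithin, mem_nhdsWithin_of_mem_nhds (lt_mem_nhds
      (a := max (1 / 2) (1 + l / 2)) (b := (1 : ℝ))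
      (max_lt (by norm_num) (by linarith)))] with α h1 h2 using ⟨h1, h2⟩
  filter_upwards [hev] with α ⟨h1, h2⟩ z hz
  have hα : 1 / 2 < α := (le_max_left _ _).trans_lt h2
  have hαl : 1 + l / 2 < α := (le_max_right _ _).trans_lt h2
  have hz0 : 0 < z := by linarith
  have hQ : Qaz α z A B < reTrace A * Real.exp (c * (α - 1)) := by
    rcases lt_or_ge z 1 with hz1 | hz1
    · refine (Qaz_le_of_lt_one D D' α (by linarith) hz1).trans_lt ?_
      have ht : (α - 1) / z ∈ Set.Ioo l 0 :=
        ⟨by rw [lt_div_iff₀ hz0]; nlinarith, div_neg_of_neg_of_pos (by linarith) hz0⟩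
      have h3 := Real.rpow_lt_rpow (petzSum_nonneg D D' _) (hlt ht) hz0
      have h4 := mul_lt_mul_of_pos_left h3 (Real.rpow_pos_of_pos hA0 (1 - z))
      refine h4.trans_eq ?_
      rw [Real.mul_rpow hA0.le (Real.exp_pos _).le, ← mul_assoc, ← Real.rpow_add hA0,
        ← Real.exp_mul]
      simp only [sub_add_cancel, Real.rpow_one]
      congr 2
      field_simp
    · exact (Qaz_le_of_one_le D D' α hz1).trans_lt
        (hlt ⟨by linarith, by linarith⟩)
  rw [Daz]
  split_ifs with h
  · have hQ0 : 0 < Qaz α z A B := lt_of_le_of_ne (Qaz_nonneg D D' α hz0) (Ne.symm h.2)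
    have h5 := Real.log_lt_log hQ0 hQ
    rw [Real.log_mul hA0.ne' (Real.exp_pos _).ne', Real.log_exp] at h5
    rw [EReal.coe_lt_coe_iff, ← div_eq_inv_mul, lt_div_iff_of_neg (sub_neg.2 h1)]
    linarith
  · exact EReal.coe_lt_top c

lemma mul_eq_zero_of_suppLE {A B X : Matrix ι ι ℂ} (h : suppLE A B)
    (hX : B * X = 0) : A * X = 0 := by
  ext i j
  have h1 : B.mulVec (fun k => X k j) = 0 := funext fun k => congrFun (congrFun hX k) j
  exact congrFun (h _ h1) i

lemma posSemidef_conj_realDiag {U : Matrix ι ι ℂ} {x : ι → ℝ} (hx : ∀ i, 0 ≤ x i) :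
    (U * realDiag x * star U).PosSemidef := by
  have h : (realDiag x).PosSemidef := Matrix.PosSemidef.diagonal fun i => by
    simpa using hx i
  exact h.mul_mul_conjTranspose_same U

lemma conj_one_eq {U : Matrix ι ι ℂ} (hU : U ∈ Matrix.unitaryGroup ι ℂ) (c : ℝ) :
    U * realDiag (fun _ => c) * star U = c • (1 : Matrix ι ι ℂ) := by
  have : realDiag (fun _ : ι => c) = c • (1 : Matrix ι ι ℂ) := by
    ext i j
    by_cases h : i = j <;> simp [realDiag, h]
  rw [this, Matrix.mul_smul, Matrix.mul_one, Matrix.smul_mul, Matrix.mem_unitaryGroup_iff.1 hU]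

lemma realDiag_sub (x y : ι → ℝ) : realDiag x - realDiag y = realDiag fun i => x i - y i := by
  ext i j
  by_cases h : i = j <;> simp [realDiag, h]

lemma realDiag_smul (c : ℝ) (x : ι → ℝ) : c • realDiag x = realDiag fun i => c * x i := by
  ext i j
  by_cases h : i = j <;> simp [realDiag, h]

lemma loewnerLE_reTrace_smul_one {A : Matrix ι ι ℂ} (hA : A.PosSemidef) :
    loewnerLE A (reTrace A • (1 : Matrix ι ι ℂ)) := by
  obtain ⟨D⟩ := exists_spectralData hA
  have e : reTrace A • (1 : Matrix ι ι ℂ) - A =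
      D.U * realDiag (fun i => reTrace A - D.eig i) * star D.U := by
    rw [← realDiag_sub, Matrix.mul_sub, Matrix.sub_mul, conj_one_eq D.mem_unitary, ← D.eq]
  rw [loewnerLE, e]
  refine posSemidef_conj_realDiag fun i => ?_
  rw [D.reTrace_eq, sub_nonneg]
  exact Finset.single_le_sum (fun i _ => D.eig_nonneg i) (Finset.mem_univ i)

/-- Domination of supports implies domination up to a constant. -/
lemma exists_loewnerLE_smul_of_suppLE {A B : Matrix ι ι ℂ} (hA : A.PosSemidef)
    (hB : B.PosSemidef) (h : suppLE A B) : ∃ c : ℝ, 0 ≤ c ∧ loewnerLE A (c • B) := by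
  obtain ⟨D⟩ := exists_spectralData hB
  have hU := Matrix.mem_unitaryGroup_iff'.1 D.mem_unitary
  set τ := reTrace A with hτ
  have hτ0 : 0 ≤ τ := by
    obtain ⟨DA⟩ := exists_spectralData hA
    exact DA.reTrace_nonneg
  set g : ι → ℝ := fun i => suppPow (D.eig i) 0 with hg
  set c := τ * ∑ i, suppPow (D.eig i) (-1) with hc
  have hc0 : 0 ≤ c :=
    mul_nonneg hτ0 (Finset.sum_nonneg fun i _ => suppPow_nonneg (D.eig_nonneg i) _)
  set S := D.U * realDiag g * star D.U with hS
  have hgg : ∀ i, g i * g i = g i := fun i => by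
    rw [hg]; dsimp only; rw [suppPow_mul (D.eig_nonneg i), add_zero]
  have hSS : S * S = S := by
    calc S * S = D.U * realDiag g * (star D.U * D.U) * realDiag g * star D.U := by
          simp only [hS, Matrix.mul_assoc]
      _ = S := by rw [hU, Matrix.mul_one, Matrix.mul_assoc D.U, realDiag_mul, funext hgg]
  have hSst : star S = S := by
    rw [hS]; simp only [star_mul, star_star, star_realDiag, Matrix.mul_assoc]
  have hBS : B * S = B := by
    calc B * S = (D.U * realDiag D.eig * star D.U) * S := by rw [← D.eq]
      _ = D.U * realDiag D.eig * (star D.U * D.U) * realDiag g * star D.U := by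
          simp only [hS, Matrix.mul_assoc]
      _ = D.U * realDiag D.eig * star D.U := by
          rw [hU, Matrix.mul_one, Matrix.mul_assoc D.U, realDiag_mul]
          congr 3; ext i
          have e := suppPow_mul (D.eig_nonneg i) 1 0
          rwa [add_zero, suppPow_one] at e
      _ = B := D.eq.symm
  have hAS : A * S = A := by
    have := mul_eq_zero_of_suppLE h (X := 1 - S)
      (by rw [Matrix.mul_sub, Matrix.mul_one, hBS, sub_self])
    rw [Matrix.mul_sub, Matrix.mul_one, sub_eq_zero] at this
    exact this.symm
  have hSA : S * A = A := by
    have e := congrArg star hAS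
    rwa [star_mul, hSst, show star A = A from hA.1] at e
  refine ⟨c, hc0, ?_⟩
  have h1 : (τ • S - A).PosSemidef := by
    have := (loewnerLE_reTrace_smul_one hA).mul_mul_conjTranspose_same S
    rw [← Matrix.star_eq_conjTranspose, hSst, Matrix.mul_sub, Matrix.sub_mul, hSA, hAS,
      Matrix.mul_smul, Matrix.smul_mul, Matrix.mul_one, hSS] at this
    exact this
  have h2 : (c • B - τ • S).PosSemidef := by
    have e : c • B - τ • S = D.U * realDiag (fun i => c * D.eig i - τ * g i) * star D.U := by
      rw [← realDiag_sub, ← realDiag_smul, ← realDiag_smul, Matrix.mul_sub, Matrix.sub_mul,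
        Matrix.mul_smul, Matrix.mul_smul, Matrix.smul_mul, Matrix.smul_mul, ← D.eq]
    rw [e]
    refine posSemidef_conj_realDiag fun i => ?_
    have e1 : suppPow (D.eig i) (-1) ≤ ∑ i, suppPow (D.eig i) (-1) :=
      Finset.single_le_sum (fun i _ => suppPow_nonneg (D.eig_nonneg i) _) (Finset.mem_univ i)
    have e2 := suppPow_mul (D.eig_nonneg i) (-1) 1
    rw [suppPow_one, neg_add_cancel] at e2
    rw [sub_nonneg, hg]
    dsimp only
    rw [← e2, hc, mul_assoc]
    exact mul_le_mul_of_nonneg_left (mul_le_mul_of_nonneg_right e1 (D.eig_nonneg i)) hτ0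
  have : c • B - A = (c • B - τ • S) + (τ • S - A) := by abel
  rw [loewnerLE, this]
  exact h2.add h1

section Channel

variable {n m : ℕ} (N N₁ N₂ : Matrix (Fin n) (Fin n) ℂ →ₗ[ℂ] Matrix (Fin m) (Fin m) ℂ)

/-- The Choi matrix of a linear map. -/
def choi : Matrix (Fin n × Fin m) (Fin n × Fin m) ℂ :=
  Matrix.of fun p q => N (Matrix.single p.1 q.1 1) p.2 q.2

lemma apply_eq_sum_choi (X : Matrix (Fin n) (Fin n) ℂ) (x y : Fin m) :
    N X x y = ∑ a, ∑ b, X a b * choi N (a, x) (b, y) := by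
  conv_lhs => rw [Matrix.matrix_eq_sum_single X]
  simp only [map_sum, Matrix.sum_apply]
  refine Finset.sum_congr rfl fun a _ => Finset.sum_congr rfl fun b _ => ?_
  have : Matrix.single a b (X a b) = X a b • Matrix.single a b 1 := by
    rw [Matrix.smul_single, smul_eq_mul, mul_one]
  rw [this, map_smul, Matrix.smul_apply, smul_eq_mul]
  rfl

lemma ampl_apply_eq (d : ℕ) (X : Matrix (Fin d × Fin n) (Fin d × Fin n) ℂ)
    (p q : Fin d × Fin m) : ampl d N X p q =
      ∑ a, ∑ b, X (p.1, a) (q.1, b) * choi N (a, p.2) (b, q.2) :=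
  apply_eq_sum_choi N _ _ _

/-- The unnormalized maximally entangled vector. -/
def entangledVec (n : ℕ) : Fin n × Fin n → ℂ := fun p => if p.1 = p.2 then 1 else 0

/-- The unnormalized maximally entangled state. -/
def entangled (n : ℕ) : Matrix (Fin n × Fin n) (Fin n × Fin n) ℂ :=
  Matrix.vecMulVec (entangledVec n) (star (entangledVec n))

lemma ampl_smul_entangled (c : ℂ) : ampl n N (c • entangled n) = c • choi N := by
  ext p q
  rw [ampl_apply_eq, Matrix.smul_apply]
  simp [entangled, entangledVec, Matrix.vecMulVec_apply]

lemma trace_entangled : (entangled n).trace = n := by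
  simp [entangled, entangledVec, Matrix.trace, Matrix.vecMulVec_apply, Fintype.sum_prod_type]

lemma posSemidef_entangled : (entangled n).PosSemidef := Matrix.posSemidef_vecMulVec_self_star _

variable {N N₁ N₂}

lemma choi_posSemidef (h : IsCP N) : (choi N).PosSemidef := by
  have := h n _ ((posSemidef_entangled (n := n)))
  rwa [← one_smul ℂ (entangled n), ampl_smul_entangled, one_smul] at this

lemma loewnerLE_ampl {c : ℝ} (h : loewnerLE (choi N₁) (c • choi N₂)) {d : ℕ}
    {ρ : Matrix (Fin d × Fin n) (Fin d × Fin n) ℂ} (hρ : ρ.PosSemidef) :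
    loewnerLE (ampl d N₁ ρ) (c • ampl d N₂ ρ) := by
  obtain ⟨k, v, rfl⟩ := Matrix.posSemidef_iff_eq_sum_vecMulVec.1 hρ
  set Δ := c • choi N₂ - choi N₁ with hΔ
  set K : Fin k → Matrix (Fin d × Fin m) (Fin n × Fin m) ℂ := fun l =>
    Matrix.of fun p a => if p.2 = a.2 then v l (p.1, a.1) else 0 with hK
  have : c • ampl d N₂ (∑ l, Matrix.vecMulVec (v l) (star (v l))) -
      ampl d N₁ (∑ l, Matrix.vecMulVec (v l) (star (v l))) =
      ∑ l, K l * Δ * (K l).conjTranspose := by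
    ext p q
    have e : ∀ l, (K l * Δ * (K l).conjTranspose) p q =
        ∑ a, ∑ b, (v l (p.1, a) * star (v l (q.1, b))) * Δ (a, p.2) (b, q.2) := fun l => by
      rw [Matrix.mul_apply, Finset.sum_comm]
      simp only [Matrix.mul_apply, hK, Matrix.conjTranspose_apply, Matrix.of_apply,
        Fintype.sum_prod_type, ite_mul, zero_mul, Finset.sum_ite_eq, Finset.mem_univ, if_true,
        apply_ite star, star_zero, mul_ite, mul_zero, Finset.sum_mul]
      refine Finset.sum_congr rfl fun b _ => Finset.sum_congr rfl fun a _ => ?_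
      ring
    rw [Matrix.sub_apply, Matrix.smul_apply, ampl_apply_eq, ampl_apply_eq, Matrix.sum_apply]
    simp only [e, Matrix.sum_apply, Matrix.vecMulVec_apply, Pi.star_apply, Finset.sum_mul]
    rw [Finset.sum_comm (γ := Fin k)]
    simp only [Finset.smul_sum, ← Finset.sum_sub_distrib]
    refine Finset.sum_congr rfl fun a _ => ?_
    rw [Finset.sum_comm (γ := Fin k)]
    refine Finset.sum_congr rfl fun b _ => Finset.sum_congr rfl fun l _ => ?_
    simp only [hΔ, Matrix.sub_apply, Matrix.smul_apply, Complex.real_smul]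
    ring
  rw [loewnerLE, this]
  exact Matrix.posSemidef_sum _ fun l _ => h.mul_mul_conjTranspose_same (K l)

end Channel

section Trace

variable {n m : ℕ} {N N₁ N₂ : Matrix (Fin n) (Fin n) ℂ →ₗ[ℂ] Matrix (Fin m) (Fin m) ℂ}

/-- The matrix of the functional `X ↦ Tr (N X)`, a partial trace of the Choi matrix. -/
def traceGram (N : Matrix (Fin n) (Fin n) ℂ →ₗ[ℂ] Matrix (Fin m) (Fin m) ℂ) :
    Matrix (Fin n) (Fin n) ℂ :=
  ∑ x, (choi N).submatrix (fun a => (a, x)) fun a => (a, x)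

lemma trace_apply_vecMulVec (v : Fin n → ℂ) :
    (N (Matrix.vecMulVec (star v) v)).trace = star v ⬝ᵥ (traceGram N).mulVec v := by
  simp only [Matrix.trace, Matrix.diag_apply, apply_eq_sum_choi N, Matrix.vecMulVec_apply,
    dotProduct, Matrix.mulVec, traceGram, Matrix.sum_apply, Matrix.submatrix_apply]
  rw [Finset.sum_comm]
  refine Finset.sum_congr rfl fun a _ => ?_
  rw [Finset.sum_comm, Finset.mul_sum]
  refine Finset.sum_congr rfl fun b _ => ?_
  rw [Finset.sum_mul, Finset.mul_sum]
  exact Finset.sum_congr rfl fun x _ => by ring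

lemma traceGram_posSemidef (h : IsCP N) : (traceGram N).PosSemidef :=
  Matrix.posSemidef_sum _ fun _ _ => (choi_posSemidef h).submatrix _

lemma exists_reTrace_le (h₁ : IsCPplus N₁) (h₂ : IsCPplus N₂) :
    ∃ K : ℝ, 0 ≤ K ∧ ∀ X : Matrix (Fin n) (Fin n) ℂ, X.PosSemidef →
      reTrace (N₂ X) ≤ K * reTrace (N₁ X) := by
  obtain ⟨K, hK, hle⟩ := exists_loewnerLE_smul_of_suppLE (traceGram_posSemidef h₂.1)
    (traceGram_posSemidef h₁.1) fun v hv => by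
      have h0 : v = 0 := by
        by_contra hne
        have h1 := trace_apply_vecMulVec (N := N₁) v
        rw [hv, dotProduct_zero] at h1
        have h2 : Matrix.vecMulVec (star v) v ≠ 0 := fun h => hne (by
          ext i
          have := congrFun (congrFun h i) i
          rw [Matrix.vecMulVec_apply] at this
          simpa using this)
        have h3 : PSDne (N₁ (Matrix.vecMulVec (star v) v)) :=
          h₁.2 _ (Matrix.posSemidef_vecMulVec_star_self v) h2
        have h4 := h3.reTrace_pos
        rw [reTrace, h1] at h4
        simp at h4
      rw [h0, Matrix.mulVec_zero]
  refine ⟨K, hK, fun X hX => ?_⟩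
  obtain ⟨k, v, rfl⟩ := Matrix.posSemidef_iff_eq_sum_vecMulVec.1 hX
  simp only [reTrace, map_sum, Matrix.trace_sum, Complex.re_sum, Finset.mul_sum]
  refine Finset.sum_le_sum fun l _ => ?_
  have e : ∀ M : Matrix (Fin n) (Fin n) ℂ →ₗ[ℂ] Matrix (Fin m) (Fin m) ℂ,
      (M (Matrix.vecMulVec (v l) (star (v l)))).trace =
        star (star (v l)) ⬝ᵥ (traceGram M).mulVec (star (v l)) := fun M => by
    rw [← trace_apply_vecMulVec, star_star]
  have h5 := (Complex.le_def.1 (hle.dotProduct_mulVec_nonneg (star (v l)))).1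
  rw [Matrix.sub_mulVec, dotProduct_sub, Matrix.smul_mulVec, dotProduct_smul, ← e N₁, ← e N₂] at h5
  simpa using h5

lemma reTrace_ampl (d : ℕ) (ρ : Matrix (Fin d × Fin n) (Fin d × Fin n) ℂ) :
    reTrace (ampl d N ρ) = ∑ p, reTrace (N (ρ.submatrix (fun a => (p, a)) fun a => (p, a))) := by
  simp only [reTrace, Matrix.trace, Complex.re_sum, Fintype.sum_prod_type]
  rfl

lemma psdne_ampl (h : IsCPplus N) {d : ℕ} {ρ : Matrix (Fin d × Fin n) (Fin d × Fin n) ℂ}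
    (hρ : ρ.PosSemidef ∧ ρ.trace = 1) : PSDne (ampl d N ρ) := by
  refine ⟨h.1 d ρ hρ.1, fun h0 => ?_⟩
  have hblock : ∀ p, (ρ.submatrix (fun a : Fin n => (p, a)) fun a => (p, a)).PosSemidef :=
    fun p => hρ.1.submatrix _
  have hnonneg : ∀ p, 0 ≤ reTrace (N (ρ.submatrix (fun a : Fin n => (p, a)) fun a => (p, a))) :=
    fun p => by
      by_cases hp : ρ.submatrix (fun a : Fin n => (p, a)) (fun a => (p, a)) = 0
      · rw [hp, map_zero, reTrace, Matrix.trace_zero, Complex.zero_re]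
      · exact (PSDne.reTrace_pos (h.2 _ (hblock p) hp)).le
  have h1 := reTrace_ampl (N := N) d ρ
  rw [h0, reTrace, Matrix.trace_zero, Complex.zero_re, eq_comm,
    Finset.sum_eq_zero_iff_of_nonneg fun p _ => hnonneg p] at h1
  have h2 : ∀ p, ρ.submatrix (fun a : Fin n => (p, a)) (fun a => (p, a)) = 0 := fun p => by
    by_contra hp
    exact (PSDne.reTrace_pos (h.2 _ (hblock p) hp)).ne' (h1 p (Finset.mem_univ p))
  have h3 : ρ.trace = 0 := by
    rw [Matrix.trace, Fintype.sum_prod_type]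
    exact Finset.sum_eq_zero fun p _ => Finset.sum_eq_zero fun a _ =>
      congrFun (congrFun (h2 p) a) a
  exact one_ne_zero (hρ.2.symm.trans h3)

lemma le_chDiv (D : ∀ (k : ℕ), Matrix (Fin k × Fin m) (Fin k × Fin m) ℂ →
      Matrix (Fin k × Fin m) (Fin k × Fin m) ℂ → EReal) {d : ℕ}
    {ρ : Matrix (Fin d × Fin n) (Fin d × Fin n) ℂ} (hρ : ρ.PosSemidef ∧ ρ.trace = 1) :
    D d (ampl d N₁ ρ) (ampl d N₂ ρ) ≤ chDiv D N₁ N₂ :=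
  le_iSup_of_le d (le_iSup_of_le ρ (le_iSup_of_le hρ le_rfl))

lemma chDiv_le (D : ∀ (k : ℕ), Matrix (Fin k × Fin m) (Fin k × Fin m) ℂ →
      Matrix (Fin k × Fin m) (Fin k × Fin m) ℂ → EReal) {b : EReal}
    (h : ∀ (d : ℕ) (ρ : Matrix (Fin d × Fin n) (Fin d × Fin n) ℂ),
      ρ.PosSemidef ∧ ρ.trace = 1 → D d (ampl d N₁ ρ) (ampl d N₂ ρ) ≤ b) :
    chDiv D N₁ N₂ ≤ b :=
  iSup_le fun d => iSup_le fun ρ => iSup_le fun hρ => h d ρ hρ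

lemma suppLE_of_chDiv_DUm_lt_top (h : chDiv (fun _ ρ σ => DUm ρ σ) N₁ N₂ < ⊤) {d : ℕ}
    {ρ : Matrix (Fin d × Fin n) (Fin d × Fin n) ℂ} (hρ : ρ.PosSemidef ∧ ρ.trace = 1) :
    suppLE (ampl d N₁ ρ) (ampl d N₂ ρ) := by
  by_contra hn
  have := (le_chDiv (fun _ ρ σ => DUm ρ σ) hρ).trans_lt h
  rw [DUm, if_neg hn] at this
  exact lt_irrefl _ this

lemma exists_loewnerLE_ampl (h₁ : IsCP N₁) (h₂ : IsCP N₂)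
    (h : chDiv (fun _ ρ σ => DUm ρ σ) N₁ N₂ < ⊤) :
    ∃ c : ℝ, 0 ≤ c ∧ ∀ (d : ℕ) (ρ : Matrix (Fin d × Fin n) (Fin d × Fin n) ℂ),
      ρ.PosSemidef ∧ ρ.trace = 1 → loewnerLE (ampl d N₁ ρ) (c • ampl d N₂ ρ) := by
  rcases Nat.eq_zero_or_pos n with rfl | hn
  · refine ⟨0, le_rfl, fun d ρ hρ => absurd hρ.2 ?_⟩
    simp [Matrix.trace]
  have hn' : (n : ℂ) ≠ 0 := by exact_mod_cast hn.ne'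
  have hsupp : suppLE (choi N₁) (choi N₂) := fun v hv => by
    have hρ : ((n : ℂ)⁻¹ • entangled n).PosSemidef ∧ ((n : ℂ)⁻¹ • entangled n).trace = 1 := by
      refine ⟨posSemidef_entangled.smul (by positivity), ?_⟩
      rw [Matrix.trace_smul, trace_entangled, smul_eq_mul, inv_mul_cancel₀ hn']
    have h3 := suppLE_of_chDiv_DUm_lt_top h hρ v
    rw [ampl_smul_entangled, ampl_smul_entangled, Matrix.smul_mulVec, Matrix.smul_mulVec, hv,
      smul_zero] at h3
    exact (smul_eq_zero.1 (h3 rfl)).resolve_left (inv_ne_zero hn')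
  obtain ⟨c, hc, hle⟩ := exists_loewnerLE_smul_of_suppLE (choi_posSemidef h₁) (choi_posSemidef h₂)
    hsupp
  exact ⟨c, hc, fun d ρ hρ => loewnerLE_ampl hle hρ.1⟩

lemma eventually_lt_chDiv_Daz (h₁ : IsCPplus N₁) (h₂ : IsCPplus N₂) {b : EReal}
    (hb : b < chDiv (fun _ ρ σ => DUm ρ σ) N₁ N₂) :
    ∀ᶠ α in 𝓝[≠] (1 : ℝ), ∀ z, min α 1 ≤ z → b < chDiv (fun _ ρ σ => Daz α z ρ σ) N₁ N₂ := by
  rw [← nhdsLT_sup_nhdsGT, eventually_sup]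
  constructor
  · simp only [chDiv, lt_iSup_iff] at hb
    obtain ⟨d, ρ, hρ, hb⟩ := hb
    obtain ⟨c, hbc, hc⟩ := EReal.lt_iff_exists_real_btwn.1 hb
    filter_upwards [exists_lt_Daz (psdne_ampl h₁ hρ) (psdne_ampl h₂ hρ).1 hc,
      self_mem_nhdsWithin] with α hα hα1 z hz
    have hα1' : α < 1 := hα1
    rw [min_eq_left hα1'.le] at hz
    exact (hbc.trans (hα z hz)).trans_le (le_chDiv (fun _ ρ σ => Daz α z ρ σ) hρ)
  · filter_upwards [self_mem_nhdsWithin] with α hα z hz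
    have hα' : 1 < α := hα
    rw [min_eq_right hα'.le] at hz
    refine hb.trans_le (chDiv_le _ fun d ρ hρ => ?_)
    exact (DUm_le_Daz (psdne_ampl h₁ hρ) (psdne_ampl h₂ hρ).1 hα' (by linarith)).trans
      (le_chDiv (fun _ ρ σ => Daz α z ρ σ) hρ)

lemma eventually_chDiv_Daz_lt (h₁ : IsCPplus N₁) (h₂ : IsCPplus N₂) {b : EReal}
    (hb : chDiv (fun _ ρ σ => DUm ρ σ) N₁ N₂ < b) :
    ∀ᶠ α in 𝓝[≠] (1 : ℝ), ∀ z, min α 1 ≤ z → chDiv (fun _ ρ σ => Daz α z ρ σ) N₁ N₂ < b := by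
  rw [← nhdsLT_sup_nhdsGT, eventually_sup]
  constructor
  · filter_upwards [self_mem_nhdsWithin, mem_nhdsWithin_of_mem_nhds (lt_mem_nhds
      (a := (1 / 2 : ℝ)) (b := (1 : ℝ)) (by norm_num))] with α hα hα2 z hz
    have hα' : α < 1 := hα
    rw [min_eq_left hα'.le] at hz
    refine (chDiv_le _ fun d ρ hρ => ?_).trans_lt hb
    exact (Daz_le_DUm (psdne_ampl h₁ hρ) (psdne_ampl h₂ hρ).1 hα' (hα2.trans_le hz)).trans
      (le_chDiv (fun _ ρ σ => DUm ρ σ) hρ)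
  · have htop := hb.trans_le le_top
    obtain ⟨c, hc, hle⟩ := exists_loewnerLE_ampl h₁.1 h₂.1 htop
    obtain ⟨K, hK, htr⟩ := exists_reTrace_le h₁ h₂
    obtain ⟨r, hr, hrb⟩ := EReal.lt_iff_exists_real_btwn.1 hb
    obtain ⟨r', hr', hrb'⟩ := EReal.lt_iff_exists_real_btwn.1 hrb
    rw [EReal.coe_lt_coe_iff] at hr'
    have hcont : Continuous fun α : ℝ => 8 * (c + K) * (α - 1) := by fun_prop
    have hsmall : ∀ᶠ α in 𝓝 (1 : ℝ), 8 * (c + K) * (α - 1) < r' - r :=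
      hcont.continuousAt.eventually_lt continuousAt_const (by simpa using hr')
    filter_upwards [self_mem_nhdsWithin, mem_nhdsWithin_of_mem_nhds hsmall,
      mem_nhdsWithin_of_mem_nhds (Iio_mem_nhds (show (1 : ℝ) < 3 / 2 by norm_num))]
      with α hα hα2 hα3 z hz
    have hα' : 1 < α := hα
    rw [min_eq_right hα'.le] at hz
    refine (chDiv_le _ fun d ρ hρ => ?_).trans_lt hrb'
    have hK' : reTrace (ampl d N₂ ρ) ≤ K * reTrace (ampl d N₁ ρ) := by
      rw [reTrace_ampl, reTrace_ampl, Finset.mul_sum]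
      exact Finset.sum_le_sum fun p _ => htr _ (hρ.1.submatrix _)
    calc Daz α z (ampl d N₁ ρ) (ampl d N₂ ρ)
        ≤ DUm (ampl d N₁ ρ) (ampl d N₂ ρ) + ((8 * (c + K) * (α - 1) : ℝ) : EReal) :=
          Daz_le_add (psdne_ampl h₁ hρ) (psdne_ampl h₂ hρ).1 (suppLE_of_chDiv_DUm_lt_top htop hρ)
            hc (hle d ρ hρ) hK' hα' (le_of_lt hα3) hz
      _ ≤ (r : EReal) + ((8 * (c + K) * (α - 1) : ℝ) : EReal) :=
          add_le_add ((le_chDiv (fun _ ρ σ => DUm ρ σ) hρ).trans hr.le) le_rfl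
      _ ≤ (r' : EReal) := by
          rw [← EReal.coe_add, EReal.coe_le_coe_iff]
          linarith

lemma tendsto_chDiv_Dfull (h₁ : IsCPplus N₁) (h₂ : IsCPplus N₂) {z : ℝ → ℝ} {l : Filter ℝ}
    (hl : l ≤ 𝓝[≠] (1 : ℝ)) (hz : ∀ᶠ α in l, min α 1 ≤ z α) :
    Tendsto (fun α : ℝ => chDiv (fun _ ρ σ => Dfull α (z α) ρ σ) N₁ N₂) l
      (𝓝 (chDiv (fun _ ρ σ => DUm ρ σ) N₁ N₂)) := by
  have e : (fun α : ℝ => chDiv (fun _ ρ σ => Daz α (z α) ρ σ) N₁ N₂) =ᶠ[l]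
      fun α : ℝ => chDiv (fun _ ρ σ => Dfull α (z α) ρ σ) N₁ N₂ := by
    filter_upwards [hl self_mem_nhdsWithin] with α hα
    have hα' : α ≠ 1 := hα
    simp only [Dfull, if_neg hα']
  refine Tendsto.congr' e (tendsto_order.2 ⟨fun b hb => ?_, fun b hb => ?_⟩)
  · filter_upwards [hl (eventually_lt_chDiv_Daz h₁ h₂ hb), hz] with α h hα using h _ hα
  · filter_upwards [hl (eventually_chDiv_Daz_lt h₁ h₂ hb), hz] with α h hα using h _ hα

end Trace

/-- For `N₁, N₂ ∈ CP⁺`, the Petz-type and sandwiched channel Rényi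
divergences converge to the channel Umegaki relative entropy as `α → 1`; more generally
so does `D_{α,z(α)}(N₁‖N₂)` whenever `min{α,1} ≤ z(α)` on an interval around `1`. -/
theorem channel_renyi_limit_at_one {n m : ℕ}
    (N₁ N₂ : Matrix (Fin n) (Fin n) ℂ →ₗ[ℂ] Matrix (Fin m) (Fin m) ℂ)
    (h₁ : IsCPplus (⇑N₁)) (h₂ : IsCPplus (⇑N₂)) :
    Filter.Tendsto (fun α : ℝ => chDiv (fun _ ρ σ => Dfull α 1 ρ σ) N₁ N₂)
      (𝓝[≠] (1 : ℝ)) (𝓝 (chDiv (fun _ ρ σ => DUm ρ σ) N₁ N₂)) ∧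
    Filter.Tendsto (fun α : ℝ => chDiv (fun _ ρ σ => Dfull α α ρ σ) N₁ N₂)
      (𝓝[≠] (1 : ℝ)) (𝓝 (chDiv (fun _ ρ σ => DUm ρ σ) N₁ N₂)) ∧
    ∀ J : Set ℝ, J.OrdConnected → J ⊆ Set.Ioi (0 : ℝ) → 1 ∈ J →
      ∀ z : ℝ → ℝ, (∀ α ∈ J \ {1}, min α 1 ≤ z α) →
        Filter.Tendsto (fun α : ℝ => chDiv (fun _ ρ σ => Dfull α (z α) ρ σ) N₁ N₂)
          (𝓝[J \ {1}] (1 : ℝ)) (𝓝 (chDiv (fun _ ρ σ => DUm ρ σ) N₁ N₂)) := by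
  refine ⟨tendsto_chDiv_Dfull (z := fun _ => 1) h₁ h₂ le_rfl
      (Eventually.of_forall fun α => min_le_right α 1),
    tendsto_chDiv_Dfull (z := fun α => α) h₁ h₂ le_rfl
      (Eventually.of_forall fun α => min_le_left α 1), fun J _ _ _ z hz =>
    tendsto_chDiv_Dfull h₁ h₂ (nhdsWithin_mono _ fun α hα => hα.2) ?_⟩
  filter_upwards [self_mem_nhdsWithin] with α hα using hz α hα

end QRenyi

end
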